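/- Let m > d/2 and let g ∈ C^{m+2}(𝕋^d × B, ℝ) where B ⊂ ℝ is an open ball around 0. Then for V, W ∈ H^m(𝕋^d, ℝ) ∩ L^∞ with V(𝕋^d), (V+W)(𝕋^d) ⊂ B, one has ‖g(·, V+W) − g(·, V) − ∂_x g(·, V)·W‖_{H^m} ≤ C(‖V‖_{L^∞})(1 + ‖V‖_{H^m})‖W‖²_{H^m}, where C is a constant depending on m, d, and on bounds of derivatives of g on the range of the functions. -/

import Mathlib

open MeasureTheory
open scoped BigOperators

/-- `u : ℝ^d → ℝ` is `2π`-periodic in each variable (a function on `𝕋^d`). -/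
def IsPeriodic (d : ℕ) (u : (Fin d → ℝ) → ℝ) : Prop :=
  ∀ (p : Fin d → ℤ) (θ : Fin d → ℝ),
    u (θ + fun j => 2 * Real.pi * (p j : ℝ)) = u θ

/-- `k`-th Fourier coefficient of a function on `𝕋^d`. -/
noncomputable def fcoef (d : ℕ) (u : (Fin d → ℝ) → ℝ) (k : Fin d → ℤ) : ℂ :=
  (1 / (2 * Real.pi) ^ d : ℝ) •
    ∫ θ in Set.Icc (0 : Fin d → ℝ) (fun _ => 2 * Real.pi),
      (u θ : ℂ) * Complex.exp (-Complex.I * (∑ j, (k j : ℝ) * θ j))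

/-- Squared Sobolev `H^m(𝕋^d)` norm, read off the Fourier coefficients. -/
noncomputable def sobSq (d : ℕ) (m : ℕ) (u : (Fin d → ℝ) → ℝ) : ℝ :=
  ∑' k : Fin d → ℤ, ‖fcoef d u k‖^2 * (1 + ∑ j, ((k j : ℝ))^2) ^ (m : ℝ)

/-- Sobolev `H^m(𝕋^d)` norm. -/
noncomputable def sobNorm (d : ℕ) (m : ℕ) (u : (Fin d → ℝ) → ℝ) : ℝ :=
  Real.sqrt (sobSq d m u)

namespace S15
open Set Filter Topology
open scoped Pointwise

/-- fundamental cell -/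
def cell (d : ℕ) : Set (Fin d → ℝ) := Set.Icc (0 : Fin d → ℝ) (fun _ => 2 * Real.pi)

/-- normalised measure on the cell -/
noncomputable def mu (d : ℕ) : Measure (Fin d → ℝ) :=
  ENNReal.ofReal (1 / (2 * Real.pi) ^ d) • (volume.restrict (cell d))

/-- periodicity for general targets -/
def Per {E : Type*} (d : ℕ) (u : (Fin d → ℝ) → E) : Prop :=
  ∀ (p : Fin d → ℤ) (θ : Fin d → ℝ), u (θ + fun j => 2 * Real.pi * (p j : ℝ)) = u θ

/-- exponentials -/
noncomputable def ee {d : ℕ} (k : Fin d → ℤ) (θ : Fin d → ℝ) : ℂ :=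
  Complex.exp (Complex.I * (∑ j, (k j : ℝ) * θ j))

/-- complex Fourier coefficient -/
noncomputable def cfc (d : ℕ) (u : (Fin d → ℝ) → ℂ) (k : Fin d → ℤ) : ℂ :=
  ∫ θ, u θ * ee (-k) θ ∂(mu d)

lemma isCompact_cell (d : ℕ) : IsCompact (cell d) := isCompact_Icc

lemma measurableSet_cell (d : ℕ) : MeasurableSet (cell d) := measurableSet_Icc

lemma volume_cell (d : ℕ) : volume (cell d) = ENNReal.ofReal ((2 * Real.pi) ^ d) := by
  have hp := Real.pi_pos
  rw [cell, Real.volume_Icc_pi]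
  simp [ENNReal.ofReal_pow hp.le, ENNReal.ofReal_mul, mul_pow]

instance (d : ℕ) : IsProbabilityMeasure (mu d) := ⟨by
  have hp := Real.pi_pos
  rw [mu, Measure.smul_apply, Measure.restrict_apply_univ, volume_cell, smul_eq_mul,
    ← ENNReal.ofReal_mul (by positivity)]
  rw [one_div, inv_mul_cancel₀ (by positivity)]; simp⟩

lemma integral_mu {E : Type*} [NormedAddCommGroup E] [NormedSpace ℝ E] (d : ℕ) (f : (Fin d → ℝ) → E) :
    ∫ θ, f θ ∂(mu d) = (1 / (2 * Real.pi) ^ d : ℝ) • ∫ θ in cell d, f θ := by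
  have hp := Real.pi_pos
  rw [mu, integral_smul_measure, ENNReal.toReal_ofReal (by positivity)]

lemma integrable_mu {E : Type*} [NormedAddCommGroup E] {d : ℕ} {f : (Fin d → ℝ) → E}
    (hf : Continuous f) : Integrable f (mu d) := by
  have : IntegrableOn f (cell d) volume := hf.continuousOn.integrableOn_compact (isCompact_cell d)
  exact Integrable.smul_measure this ENNReal.ofReal_ne_top

lemma ae_mu_cell (d : ℕ) : ∀ᵐ θ ∂(mu d), θ ∈ cell d := by
  apply Measure.ae_smul_measure
  exact ae_restrict_mem (measurableSet_cell d)

lemma fcoef_eq (d : ℕ) (u : (Fin d → ℝ) → ℝ) (k : Fin d → ℤ) :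
    fcoef d u k = cfc d (fun θ => (u θ : ℂ)) k := by
  rw [fcoef, cfc, integral_mu, cell]
  congr 2
  ext θ
  simp [ee]

lemma continuous_ee {d : ℕ} (k : Fin d → ℤ) : Continuous (ee k) := by
  unfold ee; fun_prop

lemma norm_ee {d : ℕ} (k : Fin d → ℤ) (θ) : ‖ee k θ‖ = 1 := by
  unfold ee
  rw [mul_comm]
  rw [Complex.norm_exp_ofReal_mul_I]

lemma per_ee {d : ℕ} (k : Fin d → ℤ) : Per d (ee k) := by
  intro p θ
  unfold ee
  rw [Complex.exp_eq_exp_iff_exists_int]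
  refine ⟨∑ j, k j * p j, ?_⟩
  simp only [Pi.add_apply]
  push_cast
  simp only [mul_add, Finset.sum_add_distrib]
  congr 1
  rw [Finset.sum_mul, Finset.mul_sum]
  refine Finset.sum_congr rfl fun j _ => ?_
  ring

noncomputable local instance : MeasureSpace UnitAddCircle := ⟨AddCircle.haarAddCircle⟩
local instance : Measure.IsAddHaarMeasure (volume : Measure UnitAddCircle) :=
  inferInstanceAs (Measure.IsAddHaarMeasure AddCircle.haarAddCircle)
local instance : IsProbabilityMeasure (volume : Measure UnitAddCircle) :=
  inferInstanceAs (IsProbabilityMeasure AddCircle.haarAddCircle)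

/-- projection to the unit torus -/
def toT {d : ℕ} (x : Fin d → ℝ) : UnitAddTorus (Fin d) := fun i => (x i : UnitAddCircle)

lemma toT_quot (d : ℕ) : IsOpenQuotientMap (toT (d := d)) := by
  have : IsOpenQuotientMap (fun x : ℝ => (x : UnitAddCircle)) :=
    QuotientAddGroup.isOpenQuotientMap_mk
  exact IsOpenQuotientMap.piMap (fun _ : Fin d => this)

lemma exists_lift {d : ℕ} (u : (Fin d → ℝ) → ℂ) (hu : Continuous u) (hp : Per d u) :
    ∃ U : C(UnitAddTorus (Fin d), ℂ), ∀ x, U (toT x) = u ((2 * Real.pi) • x) := by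
  let q : C(Fin d → ℝ, UnitAddTorus (Fin d)) := ⟨toT, (toT_quot d).continuous⟩
  have hq : IsQuotientMap q := (toT_quot d).isQuotientMap
  let v : C(Fin d → ℝ, ℂ) := ⟨fun x => u ((2 * Real.pi) • x), by fun_prop⟩
  have hv : Function.FactorsThrough v q := by
    intro a b hab
    have h1 : ∀ i, ∃ n : ℤ, a i = b i + n := by
      intro i
      have := congrFun hab i
      change ((a i : ℝ) : UnitAddCircle) = (b i : ℝ) at this
      rw [← sub_eq_zero, ← AddCircle.coe_sub, AddCircle.coe_eq_zero_iff] at this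
      obtain ⟨n, hn⟩ := this
      refine ⟨n, ?_⟩
      simp at hn
      linarith
    choose n hn using h1
    change u ((2 * Real.pi) • a) = u ((2 * Real.pi) • b)
    rw [← hp n ((2 * Real.pi) • b)]
    congr 1
    ext i
    simp [hn i]
    ring
  refine ⟨hq.lift v hv, fun x => ?_⟩
  exact DFunLike.congr_fun (hq.lift_comp v hv) x

lemma mFourier_toT {d : ℕ} (k : Fin d → ℤ) (x) :
    UnitAddTorus.mFourier k (toT x) = ee k ((2 * Real.pi) • x) := by
  simp only [UnitAddTorus.mFourier, toT, ContinuousMap.coe_mk, fourier_coe_apply, ee]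
  rw [← Complex.exp_sum]
  congr 1
  push_cast
  rw [Finset.mul_sum]
  refine Finset.sum_congr rfl fun j _ => ?_
  simp
  ring

lemma integral_T {d : ℕ} {E : Type*} [NormedAddCommGroup E] [NormedSpace ℝ E]
    (U : UnitAddTorus (Fin d) → E) (u : (Fin d → ℝ) → E)
    (h : ∀ x, U (toT x) = u ((2 * Real.pi) • x)) :
    ∫ x, U x = ∫ θ, u θ ∂(mu d) := by
  have hp := Real.pi_pos
  rw [UnitAddTorus.integral_preimage U 0, integral_mu]
  have h0 : {x : Fin d → ℝ | ∀ i, x i ∈ Ioc ((0 : Fin d → ℝ) i) ((0 : Fin d → ℝ) i + 1)} =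
    Set.pi Set.univ (fun i => Ioc ((0 : Fin d → ℝ) i) ((1 : Fin d → ℝ) i)) := by
    ext x; simp
  rw [h0, volume_pi, setIntegral_congr_set Measure.univ_pi_Ioc_ae_eq_Icc, ← volume_pi]
  have h1 := Measure.setIntegral_comp_smul (μ := (volume : Measure (Fin d → ℝ))) u
    (Icc (0 : Fin d → ℝ) 1) (R := 2 * Real.pi) (by positivity)
  have h2 : (2 * Real.pi) • Icc (0 : Fin d → ℝ) 1 = cell d := by
    ext x
    rw [mem_smul_set_iff_inv_smul_mem₀ (by positivity), cell, mem_Icc, mem_Icc]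
    simp only [Pi.le_def, Pi.smul_apply, Pi.zero_apply, Pi.one_apply, smul_eq_mul]
    have hq : 0 < 2 * Real.pi := by positivity
    refine and_congr (forall_congr' fun i => ?_) (forall_congr' fun i => ?_)
    · exact mul_nonneg_iff_of_pos_left (inv_pos.2 hq)
    · rw [inv_mul_le_iff₀ hq, mul_one]
  rw [h2] at h1
  simp only [Module.finrank_fintype_fun_eq_card, Fintype.card_fin] at h1
  rw [abs_of_pos (by positivity)] at h1
  rw [one_div, ← h1]
  refine integral_congr_ae (Eventually.of_forall fun x => ?_)
  exact h x

lemma mFourierCoeff_T {d : ℕ} (U : UnitAddTorus (Fin d) → ℂ) (u : (Fin d → ℝ) → ℂ)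
    (h : ∀ x, U (toT x) = u ((2 * Real.pi) • x)) (k) :
    UnitAddTorus.mFourierCoeff U k = cfc d u k := by
  rw [UnitAddTorus.mFourierCoeff, cfc]
  apply integral_T
  intro x
  rw [mFourier_toT, h, smul_eq_mul, mul_comm]

lemma plancherel {d : ℕ} (u : (Fin d → ℝ) → ℂ) (hu : Continuous u) (hp : Per d u) :
    HasSum (fun k => ‖cfc d u k‖ ^ 2) (∫ θ, ‖u θ‖ ^ 2 ∂(mu d)) := by
  obtain ⟨U, hU⟩ := exists_lift u hu hp
  have := UnitAddTorus.hasSum_sq_mFourierCoeff (U.toLp 2 volume ℂ)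
  simp only [UnitAddTorus.mFourierCoeff_toLp, mFourierCoeff_T U u hU] at this
  convert this using 1
  rw [← integral_T (fun x => ‖U x‖ ^ 2) (fun θ => ‖u θ‖ ^ 2) (fun x => by simp [hU])]
  apply integral_congr_ae
  filter_upwards [ContinuousMap.coeFn_toLp (𝕜 := ℂ) (p := 2) volume U] with x hx
  rw [hx]

lemma inversion {d : ℕ} (u : (Fin d → ℝ) → ℂ) (hu : Continuous u) (hp : Per d u)
    (hs : Summable (cfc d u)) (θ) : HasSum (fun k => cfc d u k * ee k θ) (u θ) := by
  obtain ⟨U, hU⟩ := exists_lift u hu hp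
  have hpi := Real.pi_pos
  have hc : UnitAddTorus.mFourierCoeff U = cfc d u := funext (mFourierCoeff_T U u hU)
  have := UnitAddTorus.hasSum_mFourier_series_apply_of_summable (f := U) (hc ▸ hs)
    (toT ((2 * Real.pi)⁻¹ • θ))
  simp only [hc, hU, mFourier_toT, smul_smul, mul_inv_cancel₀ (show 2 * Real.pi ≠ 0 by positivity),
    one_smul, smul_eq_mul] at this
  exact this

lemma cfc_ee {d : ℕ} (k l : Fin d → ℤ) : cfc d (ee l) k = if k = l then 1 else 0 := by
  rw [← mFourierCoeff_T (UnitAddTorus.mFourier l) (ee l) (mFourier_toT l)]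
  have := (orthonormal_iff_ite.mp (UnitAddTorus.orthonormal_mFourier (d := Fin d))) k l
  rw [ContinuousMap.inner_toLp] at this
  rw [← this, UnitAddTorus.mFourierCoeff]
  refine integral_congr_ae (Eventually.of_forall fun x => ?_)
  simp [UnitAddTorus.mFourier_neg, mul_comm]

end S15

open MeasureTheory
open scoped BigOperators
namespace S15
open Set Filter Topology

/-- partial derivative in direction `j` -/
noncomputable def D {d : ℕ} {E : Type*} [NormedAddCommGroup E] [NormedSpace ℝ E] (j : Fin d)
    (f : (Fin d → ℝ) → E) : (Fin d → ℝ) → E := fun θ => fderiv ℝ f θ (Pi.single j 1)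

section
variable {d : ℕ} {E : Type*} [NormedAddCommGroup E] [NormedSpace ℝ E]

lemma D_contDiff {n : ℕ} (j : Fin d) {f : (Fin d → ℝ) → E} (hf : ContDiff ℝ (n + 1 : ℕ) f) :
    ContDiff ℝ n (D j f) := by
  have := hf.fderiv_right (m := n) (by norm_cast)
  exact this.clm_apply contDiff_const

lemma Diter_contDiff {n : ℕ} (i : ℕ) (j : Fin d) {f : (Fin d → ℝ) → E}
    (hf : ContDiff ℝ (n + i : ℕ) f) : ContDiff ℝ n ((D j)^[i] f) := by
  induction i generalizing f with
  | zero => exact hf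
  | succ i ih =>
    rw [Function.iterate_succ_apply]
    exact ih (D_contDiff j hf)

lemma Diter_continuous {n : ℕ} {i : ℕ} (hi : i ≤ n) (j : Fin d) {f : (Fin d → ℝ) → E}
    (hf : ContDiff ℝ n f) : Continuous ((D j)^[i] f) := by
  have : ContDiff ℝ (0 : ℕ) ((D j)^[i] f) := Diter_contDiff i j (hf.of_le (by simpa using hi))
  exact this.continuous

lemma Per.D {f : (Fin d → ℝ) → E} (hf : Per d f) (j : Fin d) : Per d (D j f) := by
  intro p θ
  unfold S15.D
  rw [← fderiv_comp_add_right]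
  congr 2
  ext x
  exact hf p x

lemma Per.Diter {f : (Fin d → ℝ) → E} (hf : Per d f) (j : Fin d) (i : ℕ) :
    Per d ((S15.D j)^[i] f) := by
  induction i generalizing f with
  | zero => exact hf
  | succ i ih => rw [Function.iterate_succ_apply]; exact ih (hf.D j)

lemma integral_D [CompleteSpace E] {f : (Fin d → ℝ) → E} (hf : ContDiff ℝ 1 f) (hp : Per d f)
    (j : Fin d) : ∫ θ, D j f θ ∂(mu d) = 0 := by
  rw [integral_mu]
  obtain _ | n := d
  · exact j.elim0
  have hpi := Real.pi_pos
  have hdf : Differentiable ℝ f := hf.differentiable (by norm_num)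
  have key := integral_divergence_of_hasFDerivAt_off_countable' (E := E) (n := n) 0
    (fun _ => 2 * Real.pi) (fun i => by simp; positivity)
    (fun i => if i = j then f else 0) (fun i x => if i = j then fderiv ℝ f x else 0) ∅
    countable_empty (fun i => by
      by_cases h : i = j
      · simp only [h, if_true]; exact hf.continuous.continuousOn
      · simp only [h, if_false]; exact continuousOn_const)
    (fun x _ i => by
      by_cases h : i = j
      · simp only [h, if_true]; exact (hdf x).hasFDerivAt
      · simp only [h, if_false]; exact hasFDerivAt_const _ _)
    (by
      have : (fun x => ∑ i, (if i = j then fderiv ℝ f x else 0) (Pi.single i 1)) = D j f := by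
        ext x
        rw [Finset.sum_eq_single j]
        · simp [D]
        · intro b _ hb; simp [hb]
        · simp
      rw [this]
      exact (D_contDiff (n := 0) j hf).continuous.continuousOn.integrableOn_compact isCompact_Icc)
  have h1 : (fun x => ∑ i, (if i = j then fderiv ℝ f x else 0) (Pi.single i 1)) = D j f := by
    ext x
    rw [Finset.sum_eq_single j]
    · simp [D]
    · intro b _ hb; simp [hb]
    · simp
  rw [h1] at key
  unfold cell
  rw [key, Finset.sum_eq_zero, smul_zero]
  intro i _
  by_cases h : i = j
  · subst h
    simp only [if_true]
    rw [sub_eq_zero]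
    congr 1
    ext x
    have := hp (Pi.single i 1) (i.insertNth ((0 : Fin (n+1) → ℝ) i) x)
    rw [← this]
    congr 1
    ext l
    refine Fin.succAboveCases i ?_ (fun l => ?_) l
    · simp
    · simp
  · simp [h]

end

section
variable {d : ℕ}

lemma D_mul {A : Type*} [NormedCommRing A] [NormedAlgebra ℝ A] (j : Fin d) {f g : (Fin d → ℝ) → A}
    (hf : Differentiable ℝ f) (hg : Differentiable ℝ g) :
    D j (fun θ => f θ * g θ) = fun θ => D j f θ * g θ + f θ * D j g θ := by
  ext θ
  unfold D
  rw [fderiv_fun_mul (hf θ) (hg θ)]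
  simp
  ring

lemma ibp {A : Type*} [NormedCommRing A] [NormedAlgebra ℝ A] [CompleteSpace A] (j : Fin d)
    {f g : (Fin d → ℝ) → A}
    (hf : ContDiff ℝ 1 f) (hg : ContDiff ℝ 1 g) (pf : Per d f) (pg : Per d g) :
    ∫ θ, D j f θ * g θ ∂(mu d) = - ∫ θ, f θ * D j g θ ∂(mu d) := by
  have h := integral_D (hf.mul hg) (fun p θ => by simp only [pf p θ, pg p θ]) j
  rw [D_mul j (hf.differentiable (by norm_num)) (hg.differentiable (by norm_num)),
    integral_add] at h
  · exact eq_neg_of_add_eq_zero_left h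
  · exact integrable_mu ((D_contDiff (n := 0) j hf).continuous.mul hg.continuous)
  · exact integrable_mu (hf.continuous.mul (D_contDiff (n := 0) j hg).continuous)

lemma contDiff_ee (k : Fin d → ℤ) {n} : ContDiff ℝ n (ee k) := by
  unfold ee
  apply ContDiff.cexp
  apply contDiff_const.mul
  have h1 : ContDiff ℝ n (fun θ : Fin d → ℝ => (∑ j, (k j : ℝ) * θ j)) := by
    apply ContDiff.sum
    intro i _
    exact contDiff_const.mul (contDiff_apply _ _ _)
  exact Complex.ofRealCLM.contDiff.comp h1

lemma D_ee (k : Fin d → ℤ) (j : Fin d) :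
    D j (ee k) = fun θ => Complex.I * (k j : ℂ) * ee k θ := by
  ext θ
  have h1 : HasFDerivAt (fun θ : Fin d → ℝ => (∑ j, (k j : ℝ) * θ j))
      (∑ j, (k j : ℝ) • (ContinuousLinearMap.proj j : (Fin d → ℝ) →L[ℝ] ℝ)) θ := by
    apply HasFDerivAt.fun_sum
    intro i _
    exact (ContinuousLinearMap.proj (R := ℝ) i : (Fin d → ℝ) →L[ℝ] ℝ).hasFDerivAt.const_mul _
  have h2 := ((Complex.ofRealCLM.hasFDerivAt.comp θ h1).const_mul Complex.I).cexp
  unfold D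
  have h3 : (ee k) = fun θ => Complex.exp (Complex.I * (Complex.ofRealCLM ∘
    (fun θ : Fin d → ℝ => (∑ j, (k j : ℝ) * θ j))) θ) := rfl
  rw [h3, h2.fderiv]
  simp [Pi.single_apply]
  ring

lemma cfc_D (j : Fin d) {f : (Fin d → ℝ) → ℂ}
    (hf : ContDiff ℝ 1 f) (pf : Per d f) (k : Fin d → ℤ) :
    cfc d (D j f) k = Complex.I * (k j : ℂ) * cfc d f k := by
  unfold cfc
  rw [ibp j hf (contDiff_ee (-k)) pf (per_ee (-k)), D_ee, ← integral_neg,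
    ← integral_const_mul]
  congr 1
  ext θ
  simp
  ring

lemma D_ofReal (j : Fin d) {f : (Fin d → ℝ) → ℝ} (hf : Differentiable ℝ f) :
    D j (fun θ => (f θ : ℂ)) = fun θ => ((D j f θ : ℝ) : ℂ) := by
  ext θ
  unfold D
  have := (Complex.ofRealCLM.hasFDerivAt.comp θ (hf θ).hasFDerivAt).fderiv
  change fderiv ℝ (Complex.ofRealCLM ∘ f) θ _ = _
  rw [this]; simp

lemma fcoef_D (j : Fin d) {f : (Fin d → ℝ) → ℝ}
    (hf : ContDiff ℝ 1 f) (pf : Per d f) (k : Fin d → ℤ) :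
    fcoef d (D j f) k = Complex.I * (k j : ℂ) * fcoef d f k := by
  rw [fcoef_eq, fcoef_eq, ← D_ofReal j (hf.differentiable (by norm_num)), cfc_D]
  · exact Complex.ofRealCLM.contDiff.comp hf
  · intro p θ; simp only [pf p θ]

lemma norm_fcoef_Diter (j : Fin d) (i : ℕ) {f : (Fin d → ℝ) → ℝ}
    (hf : ContDiff ℝ i f) (pf : Per d f) (k : Fin d → ℤ) :
    ‖fcoef d ((D j)^[i] f) k‖ = |(k j : ℝ)| ^ i * ‖fcoef d f k‖ := by
  induction i generalizing f with
  | zero => simp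
  | succ i ih =>
    rw [Function.iterate_succ_apply, ih (D_contDiff j hf) (pf.D j),
      fcoef_D j (hf.of_le (by norm_cast; omega)) pf]
    simp [pow_succ]
    ring

lemma plancherel_real {u : (Fin d → ℝ) → ℝ} (hu : Continuous u) (hp : Per d u) :
    HasSum (fun k => ‖fcoef d u k‖ ^ 2) (∫ θ, u θ ^ 2 ∂(mu d)) := by
  have := plancherel (fun θ => (u θ : ℂ)) (by fun_prop) (fun p θ => by simp only [hp p θ])
  simpa [← fcoef_eq] using this

lemma plancherel_Diter (j : Fin d) (i : ℕ) {f : (Fin d → ℝ) → ℝ}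
    (hf : ContDiff ℝ i f) (pf : Per d f) :
    HasSum (fun k => |(k j : ℝ)| ^ (2 * i) * ‖fcoef d f k‖ ^ 2)
      (∫ θ, ((D j)^[i] f θ) ^ 2 ∂(mu d)) := by
  have := plancherel_real (Diter_continuous le_rfl j hf) (pf.Diter j i)
  simp only [norm_fcoef_Diter j i hf pf, mul_pow, ← pow_mul] at this
  simpa only [mul_comm i 2] using this

end
end S15

open MeasureTheory
open scoped BigOperators
namespace S15
open Set Filter Topology
open scoped NNReal ENNReal

/-- exponent -/
noncomputable def pe (m i : ℕ) : ℝ≥0∞ := ((i : ℝ≥0∞) / ((2 * m : ℕ) : ℝ≥0∞))⁻¹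

lemma pe_zero (m : ℕ) : pe m 0 = ⊤ := by simp [pe]

lemma pe_self {m : ℕ} (hm : m ≠ 0) : pe m m = 2 := by
  rw [pe, ENNReal.inv_div (by simp) (by simp [hm])]
  push_cast
  rw [ENNReal.mul_div_cancel_right (by simp [hm]) (by simp)]

lemma pe_holder (m i k : ℕ) : ENNReal.HolderTriple (pe m i) (pe m k) (pe m (i + k)) := by
  constructor
  simp only [pe, inv_inv]
  push_cast
  rw [ENNReal.add_div]

lemma pe_anti (m : ℕ) {i k : ℕ} (h : i ≤ k) : pe m k ≤ pe m i := by
  unfold pe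
  gcongr

lemma one_le_pe {m i : ℕ} (h : i ≤ 2 * m) : 1 ≤ pe m i := by
  unfold pe
  rw [ENNReal.one_le_inv]
  apply ENNReal.div_le_of_le_mul
  rw [one_mul]
  exact_mod_cast h

variable {d : ℕ}

lemma aesm {f : (Fin d → ℝ) → ℝ} (hf : Continuous f) : AEStronglyMeasurable f (mu d) :=
  hf.aestronglyMeasurable

lemma holder {f g : (Fin d → ℝ) → ℝ} (hf : Continuous f) (hg : Continuous g) {p q r : ℝ≥0∞}
    (h : ENNReal.HolderTriple p q r) :
    eLpNorm (fun θ => f θ * g θ) r (mu d) ≤ eLpNorm f p (mu d) * eLpNorm g q (mu d) := by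
  have := eLpNorm_smul_le_mul_eLpNorm (p := p) (q := q) (r := r) (aesm hg) (aesm hf)
  exact this

/-- weighted class of functions -/
def Q (m : ℕ) (j : Fin d) (lam : ℝ≥0) (n s : ℕ) (C : ℝ≥0) (f : (Fin d → ℝ) → ℝ) : Prop :=
  ∀ i ≤ n, eLpNorm ((D j)^[i] f) (pe m (i + s)) (mu d) ≤ ((C * lam ^ (i + s) : ℝ≥0) : ℝ≥0∞)

variable {m : ℕ} {j : Fin d} {lam : ℝ≥0} {n s : ℕ} {C : ℝ≥0} {f g : (Fin d → ℝ) → ℝ}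

lemma Q_succ (h0 : eLpNorm f (pe m s) (mu d) ≤ ((C * lam ^ s : ℝ≥0) : ℝ≥0∞))
    (h1 : Q m j lam n (s + 1) C (D j f)) : Q m j lam (n + 1) s C f := by
  intro i hi
  obtain _ | i := i
  · simpa using h0
  · have := h1 i (by omega)
    rw [Function.iterate_succ_apply]
    convert this using 3 <;> ring

lemma Q.tail (h : Q m j lam (n + 1) s C f) : Q m j lam n (s + 1) C (D j f) := by
  intro i hi
  have := h (i + 1) (by omega)
  rw [Function.iterate_succ_apply] at this
  convert this using 3 <;> ring

lemma Q.head (h : Q m j lam n s C f) : eLpNorm f (pe m s) (mu d) ≤ ((C * lam ^ s : ℝ≥0) : ℝ≥0∞) := by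
  simpa using h 0 (Nat.zero_le _)

lemma Q.mono {n' : ℕ} {C' : ℝ≥0} (h : Q m j lam n s C f) (hn : n' ≤ n) (hC : C ≤ C') :
    Q m j lam n' s C' f := by
  intro i hi
  refine (h i (hi.trans hn)).trans ?_
  gcongr

lemma Q.shift (h : Q m j lam n s C f) (hl : 1 ≤ lam) (hf : ContDiff ℝ n f) :
    Q m j lam n (s + 1) C f := by
  intro i hi
  refine (eLpNorm_le_eLpNorm_of_exponent_le (pe_anti m (by omega : i + s ≤ i + (s+1)))
    (aesm (Diter_continuous hi j hf))).trans ((h i hi).trans ?_)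
  gcongr
  simp

lemma D_add (j : Fin d) {f g : (Fin d → ℝ) → ℝ}
    (hf : Differentiable ℝ f) (hg : Differentiable ℝ g) :
    D j (fun θ => f θ + g θ) = fun θ => D j f θ + D j g θ := by
  ext θ
  unfold D
  rw [fderiv_fun_add (hf θ) (hg θ)]
  rfl

lemma Q.add {C' : ℝ≥0} (hm : n + s ≤ 2 * m) (h : Q m j lam n s C f) (h' : Q m j lam n s C' g)
    (hf : ContDiff ℝ n f) (hg : ContDiff ℝ n g) : Q m j lam n s (C + C') (fun θ => f θ + g θ) := by
  have base : ∀ s (f g : (Fin d → ℝ) → ℝ), s ≤ 2 * m → Continuous f → Continuous g →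
      eLpNorm f (pe m s) (mu d) ≤ ((C * lam ^ s : ℝ≥0) : ℝ≥0∞) →
      eLpNorm g (pe m s) (mu d) ≤ ((C' * lam ^ s : ℝ≥0) : ℝ≥0∞) →
      eLpNorm (fun θ => f θ + g θ) (pe m s) (mu d) ≤ (((C + C') * lam ^ s : ℝ≥0) : ℝ≥0∞) := by
    intro s f g hs hf hg h h'
    refine (eLpNorm_add_le (aesm hf) (aesm hg) (one_le_pe hs)).trans ?_
    refine (add_le_add h h').trans ?_
    rw [add_mul]; push_cast; rfl
  induction n generalizing s f g with
  | zero =>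
    intro i hi
    obtain rfl : i = 0 := by omega
    simp only [Function.iterate_zero, id, zero_add]
    exact base s f g (by omega) hf.continuous hg.continuous h.head h'.head
  | succ n ih =>
    apply Q_succ
    · exact base s f g (by omega) hf.continuous hg.continuous h.head h'.head
    · rw [D_add j (hf.differentiable (by simp)) (hg.differentiable (by simp))]
      exact ih (by omega) h.tail h'.tail (D_contDiff j hf) (D_contDiff j hg)

lemma Q.mul {s' : ℕ} {C' : ℝ≥0} (hm : n + s + s' ≤ 2 * m) (h : Q m j lam n s C f)
    (h' : Q m j lam n s' C' g)
    (hf : ContDiff ℝ n f) (hg : ContDiff ℝ n g) :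
    Q m j lam n (s + s') (2 ^ n * C * C') (fun θ => f θ * g θ) := by
  have base : ∀ s s' (f g : (Fin d → ℝ) → ℝ), Continuous f → Continuous g →
      eLpNorm f (pe m s) (mu d) ≤ ((C * lam ^ s : ℝ≥0) : ℝ≥0∞) →
      eLpNorm g (pe m s') (mu d) ≤ ((C' * lam ^ s' : ℝ≥0) : ℝ≥0∞) →
      eLpNorm (fun θ => f θ * g θ) (pe m (s + s')) (mu d) ≤
        (((C * C') * lam ^ (s + s') : ℝ≥0) : ℝ≥0∞) := by
    intro s s' f g hf hg h h'
    refine (holder hf hg (pe_holder m s s')).trans ?_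
    refine (mul_le_mul' h h').trans ?_
    norm_cast
    apply le_of_eq
    ring
  induction n generalizing s s' f g with
  | zero =>
    intro i hi
    obtain rfl : i = 0 := by omega
    simp only [Function.iterate_zero, id, zero_add, pow_zero, one_mul]
    exact base s s' f g hf.continuous hg.continuous h.head h'.head
  | succ n ih =>
    have e1 : (2 : ℝ≥0) ^ (n + 1) * C * C' = 2 ^ n * C * C' + 2 ^ n * C * C' := by ring
    apply Q_succ
    · refine (base s s' f g hf.continuous hg.continuous h.head h'.head).trans ?_
      gcongr
      exact le_mul_of_one_le_left (by positivity) (one_le_pow₀ (by norm_num))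
    · rw [D_mul j (hf.differentiable (by simp)) (hg.differentiable (by simp)), e1]
      have hf' : ContDiff ℝ n f := hf.of_le (by norm_cast; omega)
      have hg' : ContDiff ℝ n g := hg.of_le (by norm_cast; omega)
      apply Q.add (by omega) _ _ ((D_contDiff j hf).mul hg') (hf'.mul (D_contDiff j hg))
      · have := ih (s := s + 1) (s' := s') (by omega) h.tail (h'.mono (by omega) le_rfl)
          (D_contDiff j hf) hg'
        rwa [add_right_comm] at this
      · exact ih (s := s) (s' := s' + 1) (by omega) (h.mono (by omega) le_rfl) h'.tail
          hf' (D_contDiff j hg)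

/-- the composition space -/
abbrev ES (d : ℕ) : Type := (Fin d → ℝ) × ℝ × ℝ

/-- composition -/
def cmp (h : ES d → ℝ) (V W : (Fin d → ℝ) → ℝ) : (Fin d → ℝ) → ℝ := fun θ => h (θ, V θ, W θ)

lemma cmp_contDiff {n : WithTop ℕ∞} {h : ES d → ℝ} {V W : (Fin d → ℝ) → ℝ} (hh : ContDiff ℝ n h)
    (hV : ContDiff ℝ n V) (hW : ContDiff ℝ n W) : ContDiff ℝ n (cmp h V W) :=
  hh.comp (contDiff_id.prodMk (hV.prodMk hW))

lemma D_cmp {h : ES d → ℝ} {V W : (Fin d → ℝ) → ℝ} (hh : Differentiable ℝ h)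
    (hV : Differentiable ℝ V) (hW : Differentiable ℝ W) (j : Fin d) :
    D j (cmp h V W) = fun θ => cmp (fun p => fderiv ℝ h p (Pi.single j 1, 0, 0)) V W θ +
      (cmp (fun p => fderiv ℝ h p (0, 1, 0)) V W θ * D j V θ +
      cmp (fun p => fderiv ℝ h p (0, 0, 1)) V W θ * D j W θ) := by
  ext θ
  have h1 := (hh (θ, V θ, W θ)).hasFDerivAt.comp θ ((hasFDerivAt_id θ).prodMk
    ((hV θ).hasFDerivAt.prodMk (hW θ).hasFDerivAt))
  have h2 : cmp h V W = h ∘ fun x => (id x, V x, W x) := rfl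
  unfold D
  rw [h2, h1.fderiv]
  simp only [ContinuousLinearMap.comp_apply, ContinuousLinearMap.prod_apply, cmp]
  generalize fderiv ℝ h (θ, V θ, W θ) = L
  set a := fderiv ℝ V θ (Pi.single j 1)
  set b := fderiv ℝ W θ (Pi.single j 1)
  have : ((ContinuousLinearMap.id ℝ (Fin d → ℝ)) (Pi.single j 1), a, b) =
    ((Pi.single j 1, 0, 0) : ES d) + (a • ((0, 1, 0) : ES d) + b • ((0, 0, 1) : ES d)) := by
    simp
  rw [this, map_add, map_add, map_smul, map_smul, smul_eq_mul, smul_eq_mul]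
  ring

lemma comp_est (m : ℕ) (j : Fin d) (R K : ℝ≥0) (n : ℕ) (hn : n ≤ m) (h : ES d → ℝ)
    (hh : ContDiff ℝ n h) :
    ∃ C : ℝ≥0, ∀ lam : ℝ≥0, 1 ≤ lam → ∀ V W : (Fin d → ℝ) → ℝ, ContDiff ℝ m V → ContDiff ℝ m W →
      (∀ θ, |V θ| ≤ R) → (∀ θ, |W θ| ≤ R) → Q m j lam m 0 K V → Q m j lam m 0 K W →
      Q m j lam n 0 C (cmp h V W) := by
  have base : ∀ h : ES d → ℝ, Continuous h → ∃ C : ℝ≥0, ∀ V W : (Fin d → ℝ) → ℝ,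
      (∀ θ, |V θ| ≤ R) → (∀ θ, |W θ| ≤ R) → eLpNorm (cmp h V W) (pe m 0) (mu d) ≤ (C : ℝ≥0∞) := by
    intro h hh
    have hc : IsCompact (cell d ×ˢ (Icc (-(R : ℝ)) R ×ˢ Icc (-(R : ℝ)) R)) :=
      (isCompact_cell d).prod (isCompact_Icc.prod isCompact_Icc)
    obtain ⟨B, hB⟩ := hc.exists_bound_of_continuousOn hh.continuousOn
    refine ⟨B.toNNReal, fun V W hV hW => ?_⟩
    rw [pe_zero]
    refine (eLpNorm_le_of_ae_bound (C := B) ?_).trans ?_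
    · filter_upwards [ae_mu_cell d] with θ hθ
      exact hB (θ, V θ, W θ) ⟨hθ, abs_le.1 (hV θ), abs_le.1 (hW θ)⟩
    · simp [ENNReal.ofReal]
  induction n generalizing h with
  | zero =>
    obtain ⟨C, hC⟩ := base h hh.continuous
    refine ⟨C, fun lam hl V W _ _ hV hW _ _ => ?_⟩
    intro i hi
    obtain rfl : i = 0 := by omega
    simpa using hC V W hV hW
  | succ n ih =>
    obtain ⟨C0, hC0⟩ := base h hh.continuous
    have hd : ∀ v : ES d, ContDiff ℝ n (fun p => fderiv ℝ h p v) := fun v =>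
      (hh.fderiv_right (m := n) (by norm_cast)).clm_apply contDiff_const
    obtain ⟨C1, hC1⟩ := ih (by omega) _ (hd (Pi.single j 1, 0, 0))
    obtain ⟨C2, hC2⟩ := ih (by omega) _ (hd (0, 1, 0))
    obtain ⟨C3, hC3⟩ := ih (by omega) _ (hd (0, 0, 1))
    refine ⟨C0 + (C1 + (2 ^ n * C2 * K + 2 ^ n * C3 * K)), fun lam hl V W cV cW hV hW qV qW => ?_⟩
    have cV' : ContDiff ℝ (n + 1 : ℕ) V := cV.of_le (by norm_cast)
    have cW' : ContDiff ℝ (n + 1 : ℕ) W := cW.of_le (by norm_cast)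
    have cVn : ContDiff ℝ n V := cV.of_le (by norm_cast; omega)
    have cWn : ContDiff ℝ n W := cW.of_le (by norm_cast; omega)
    have k1 := cmp_contDiff (hd (Pi.single j 1, 0, 0)) cVn cWn
    have k2 := cmp_contDiff (hd (0, 1, 0)) cVn cWn
    have k3 := cmp_contDiff (hd (0, 0, 1)) cVn cWn
    apply Q_succ
    · refine (hC0 V W hV hW).trans ?_
      simp
    · rw [D_cmp (hh.differentiable (by simp)) (cV'.differentiable (by simp))
        (cW'.differentiable (by simp))]
      refine Q.mono (n := n) (C := (C1 + (2 ^ n * C2 * K + 2 ^ n * C3 * K))) ?_ le_rfl (by simp)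
      have qV' : Q m j lam (n + 1) 0 K V := qV.mono hn le_rfl
      have qW' : Q m j lam (n + 1) 0 K W := qW.mono hn le_rfl
      apply Q.add (by omega) _ _ k1 ((k2.mul (D_contDiff j cV')).add (k3.mul (D_contDiff j cW')))
      · exact (hC1 lam hl V W cV cW hV hW qV qW).shift hl k1
      · apply Q.add (by omega) _ _ (k2.mul (D_contDiff j cV')) (k3.mul (D_contDiff j cW'))
        · have := (hC2 lam hl V W cV cW hV hW qV qW).mul (by omega) qV'.tail k2 (D_contDiff j cV')
          simpa using this
        · have := (hC3 lam hl V W cV cW hV hW qV qW).mul (by omega) qW'.tail k3 (D_contDiff j cW')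
          simpa using this

end S15

open MeasureTheory
open scoped BigOperators
namespace S15
open Set Filter Topology
open scoped NNReal ENNReal

lemma max_principle (m : ℕ) (s : ℕ → ℝ) (B : ℝ) (hs : ∀ i, 0 ≤ s i) (h0 : s 0 ≤ B) (hm : s m ≤ B)
    (h : ∀ i, i + 2 ≤ m → s (i + 1) ^ 2 ≤ s i * s (i + 2)) : ∀ i ≤ m, s i ≤ B := by
  by_contra! hcon
  obtain ⟨i0, hi0, hB0⟩ := hcon
  obtain ⟨k, hk, hkmax⟩ := Finset.exists_max_image (Finset.range (m + 1)) s ⟨0, by simp⟩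
  have hkB : B < s k := hB0.trans_le (hkmax i0 (by simp; omega))
  -- largest maximiser
  let T := (Finset.range (m + 1)).filter (fun i => s i = s k)
  have hT : T.Nonempty := ⟨k, by simp [T] at hk ⊢; omega⟩
  obtain ⟨a, ha, hamax⟩ := T.exists_max_image id hT
  simp only [T, Finset.mem_filter, Finset.mem_range, id] at ha hamax
  have ham : a ≠ m := by rintro rfl; linarith [ha.2]
  have ha0 : a ≠ 0 := by rintro rfl; linarith [ha.2]
  obtain ⟨b, rfl⟩ : ∃ b, a = b + 1 := ⟨a - 1, by omega⟩
  have h1 := h b (by omega)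
  have h2 := hkmax b (by simp; omega)
  have h3 := hkmax (b + 2) (by simp; omega)
  have h4 : s (b + 2) ≠ s k := fun hh => by
    have := hamax (b + 2) ⟨by omega, hh⟩
    omega
  have h5 : s (b + 2) < s k := lt_of_le_of_ne h3 h4
  have hpos : 0 < s k := (hs 0).trans_lt (h0.trans_lt hkB)
  rw [ha.2] at h1
  nlinarith [hs b, hs (b+2)]

lemma log_convex (m : ℕ) (A : ℕ → ℝ) (B c lam : ℝ) (hA : ∀ i, 0 ≤ A i) (hc : 1 ≤ c)
    (hl : 1 ≤ lam) (h0 : A 0 ≤ B) (hm : A m ≤ B * lam ^ m)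
    (h : ∀ i, i + 2 ≤ m → A (i + 1) ^ 2 ≤ c * (A i * A (i + 2))) :
    ∀ i ≤ m, A i ≤ c ^ (m * m) * B * lam ^ i := by
  have hB : 0 ≤ B := (hA 0).trans h0
  have hc0 : 0 < c := by linarith
  have hl0 : 0 < lam := by linarith
  have key := max_principle m (fun i => A i / (c ^ (i * (m - i)) * lam ^ i)) B
    (fun i => div_nonneg (hA i) (by positivity)) (by simpa using h0)
    (by
      simp only [Nat.sub_self, mul_zero, pow_zero, one_mul]
      rw [div_le_iff₀ (by positivity)]; exact hm)
    (by
      intro i hi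
      obtain ⟨r, rfl⟩ : ∃ r, m = i + 2 + r := ⟨m - (i + 2), by omega⟩
      have e1 : i + 2 + r - i = r + 2 := by omega
      have e2 : i + 2 + r - (i + 1) = r + 1 := by omega
      have e3 : i + 2 + r - (i + 2) = r := by omega
      simp only [e1, e2, e3]
      rw [div_pow, div_mul_div_comm, div_le_div_iff₀ (by positivity) (by positivity)]
      have h1 := h i hi
      have e4 : (c ^ ((i + 1) * (r + 1)) * lam ^ (i + 1)) ^ 2 =
        c ^ 2 * (c ^ (i * (r + 2)) * lam ^ i * (c ^ ((i + 2) * r) * lam ^ (i + 2))) := by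
        rw [mul_pow, ← pow_mul, ← pow_mul]
        have : (i + 1) * (r + 1) * 2 = 2 + i * (r + 2) + (i + 2) * r := by ring
        rw [this]
        ring
      rw [e4]
      have hX : 0 ≤ (c ^ (i * (r + 2)) * lam ^ i * (c ^ ((i + 2) * r) * lam ^ (i + 2))) := by
        positivity
      set X := (c ^ (i * (r + 2)) * lam ^ i * (c ^ ((i + 2) * r) * lam ^ (i + 2)))
      have hY : 0 ≤ A i * A (i + 2) := mul_nonneg (hA _) (hA _)
      have hcc : c ≤ c ^ 2 := by nlinarith
      calc A (i + 1) ^ 2 * X ≤ (c * (A i * A (i + 2))) * X := by gcongr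
        _ ≤ (c ^ 2 * (A i * A (i + 2))) * X := by gcongr
        _ = _ := by ring)
  intro i hi
  have := key i hi
  rw [div_le_iff₀ (by positivity)] at this
  refine this.trans ?_
  have : c ^ (i * (m - i)) ≤ c ^ (m * m) :=
    pow_le_pow_right₀ hc (Nat.mul_le_mul hi (Nat.sub_le _ _))
  calc B * (c ^ (i * (m - i)) * lam ^ i) ≤ B * (c ^ (m * m) * lam ^ i) := by gcongr
    _ = _ := by ring

lemma hasDerivAt_phi {p : ℝ} (hp : 2 < p) (x : ℝ) :
    HasDerivAt (fun x : ℝ => |x| ^ (p - 2) * x) ((p - 1) * |x| ^ (p - 2)) x := by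
  by_cases hx : x = 0
  · subst hx
    rw [hasDerivAt_iff_tendsto_slope]
    have hc : Continuous (fun x : ℝ => |x| ^ (p - 2)) :=
      continuous_abs.rpow_const (fun _ => Or.inr (by linarith))
    have h0 : (p - 1) * |(0 : ℝ)| ^ (p - 2) = |(0 : ℝ)| ^ (p - 2) := by
      rw [abs_zero, Real.zero_rpow (by linarith), mul_zero]
    rw [h0]
    refine ((hc.tendsto 0).mono_left nhdsWithin_le_nhds).congr' ?_
    filter_upwards [self_mem_nhdsWithin] with y hy
    have hy' : y ≠ 0 := hy
    rw [slope_def_field]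
    field_simp
    simp
  · have h1 : HasDerivAt (fun x : ℝ => |x|) (SignType.sign x : ℝ) x := hasDerivAt_abs hx
    have hx' : |x| ≠ 0 := abs_ne_zero.2 hx
    have h2 := (h1.rpow_const (p := p - 2) (Or.inl hx')).mul (hasDerivAt_id x)
    refine HasDerivAt.congr_deriv h2 ?_
    simp only [id, mul_one]
    rw [Real.rpow_sub_one hx']
    have h3 : (SignType.sign x : ℝ) * x = |x| := sign_mul_self x
    field_simp
    linear_combination (p - 2) * h3

lemma contDiff_phi {p : ℝ} (hp : 2 < p) : ContDiff ℝ 1 (fun x : ℝ => |x| ^ (p - 2) * x) := by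
  rw [contDiff_one_iff_deriv]
  refine ⟨fun x => (hasDerivAt_phi hp x).differentiableAt, ?_⟩
  have : deriv (fun x : ℝ => |x| ^ (p - 2) * x) = fun x => (p - 1) * |x| ^ (p - 2) :=
    funext fun x => (hasDerivAt_phi hp x).deriv
  rw [this]
  exact continuous_const.mul (continuous_abs.rpow_const (fun _ => Or.inr (by linarith)))

variable {d : ℕ}

lemma eLpNorm_ne_top {f : (Fin d → ℝ) → ℝ} (hf : Continuous f) (p : ℝ≥0∞) :
    eLpNorm f p (mu d) ≠ ⊤ := by
  obtain ⟨B, hB⟩ := (isCompact_cell d).exists_bound_of_continuousOn hf.continuousOn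
  have : MemLp f p (mu d) := by
    refine MemLp.of_bound (aesm hf) B ?_
    filter_upwards [ae_mu_cell d] with θ hθ
    exact hB θ hθ
  exact this.2.ne

lemma gn_step {m a : ℕ} (ha : a + 2 ≤ m) (j : Fin d) {v : (Fin d → ℝ) → ℝ} (hv : ContDiff ℝ 2 v)
    (pv : Per d v) :
    eLpNorm (D j v) (pe m (a + 1)) (mu d) ^ 2 ≤ ((2 * m : ℕ) : ℝ≥0∞) *
      (eLpNorm v (pe m a) (mu d) * eLpNorm (D j (D j v)) (pe m (a + 2)) (mu d)) := by
  set w := D j v with hw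
  have cw : ContDiff ℝ 1 w := D_contDiff (n := 1) j hv
  have cDw : Continuous (D j w) := (D_contDiff (n := 0) j cw).continuous
  have hv1 : ContDiff ℝ 1 v := hv.of_le (by norm_num)
  set p : ℝ := 2 * m / (a + 1) with hp
  have ha1 : (0 : ℝ) < a + 1 := by positivity
  have hma : (a : ℝ) + 2 ≤ m := by exact_mod_cast ha
  have hp2 : 2 < p := by rw [hp, lt_div_iff₀ ha1]; linarith
  have hpe : pe m (a + 1) = ENNReal.ofReal p := by
    rw [pe, ENNReal.inv_div (by simp) (by simp), hp, ENNReal.ofReal_div_of_pos ha1]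
    congr 1
    · rw [← ENNReal.ofReal_natCast]; simp
    · rw [← ENNReal.ofReal_natCast]; simp
  set N := eLpNorm w (pe m (a + 1)) (mu d) with hN
  have hNtop : N ≠ ⊤ := eLpNorm_ne_top cw.continuous _
  by_cases hN0 : N = 0
  · rw [hN0]; simp
  -- integration by parts
  set q : ℝ := p / (p - 2) with hq
  have hp20 : 0 < p - 2 := by linarith
  have hcr : Continuous (fun θ => ‖w θ‖ ^ (p - 2)) :=
    cw.continuous.norm.rpow_const (fun _ => Or.inr hp20.le)
  have I1 : ∫ θ, ‖w θ‖ ^ p ∂(mu d) =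
      - ∫ θ, (p - 1) * ((v θ * D j w θ) * ‖w θ‖ ^ (p - 2)) ∂(mu d) := by
    have h1 := ibp j hv1 ((contDiff_phi hp2).comp cw) pv
      (fun pp θ => by simp only [Function.comp]; rw [show w (θ + fun j => 2 * Real.pi * (pp j : ℝ)) = w θ from (pv.D j) pp θ])
    have e1 : ∀ θ, D j v θ * ((fun x : ℝ => |x| ^ (p - 2) * x) ∘ w) θ = ‖w θ‖ ^ p := by
      intro θ
      simp only [Function.comp, ← hw, Real.norm_eq_abs]
      have : w θ * (|w θ| ^ (p - 2) * w θ) = |w θ| ^ (p - 2) * |w θ| ^ 2 := by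
        rw [sq_abs]; ring
      rw [this]
      by_cases h0 : w θ = 0
      · simp [h0, Real.zero_rpow (by linarith : p ≠ 0)]
      · rw [← Real.rpow_natCast, ← Real.rpow_add (abs_pos.2 h0)]; norm_num
    have e2 : ∀ θ, v θ * D j ((fun x : ℝ => |x| ^ (p - 2) * x) ∘ w) θ =
        (p - 1) * ((v θ * D j w θ) * ‖w θ‖ ^ (p - 2)) := by
      intro θ
      have := ((hasDerivAt_phi hp2 (w θ)).comp_hasFDerivAt θ
        (cw.differentiable (by norm_num) θ).hasFDerivAt).fderiv
      unfold D at this ⊢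
      rw [this]
      simp
      ring
    simpa only [e1, e2] using h1
  have I2 : N ^ p ≤ ENNReal.ofReal (p - 1) *
      eLpNorm (fun θ => (v θ * D j w θ) * ‖w θ‖ ^ (p - 2)) 1 (mu d) := by
    have e1 : N ^ p = eLpNorm (fun θ => ‖w θ‖ ^ p) 1 (mu d) := by
      rw [eLpNorm_norm_rpow w (by linarith), one_mul, ← hpe]
    have e2 : eLpNorm (fun θ => ‖w θ‖ ^ p) 1 (mu d) = ‖∫ θ, ‖w θ‖ ^ p ∂(mu d)‖ₑ := by
      rw [eLpNorm_one_eq_lintegral_enorm, ← ofReal_integral_norm_eq_lintegral_enorm]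
      · have : ∀ θ, ‖‖w θ‖ ^ p‖ = ‖w θ‖ ^ p := fun θ => Real.norm_of_nonneg (by positivity)
        simp only [this]
        rw [Real.enorm_of_nonneg (integral_nonneg fun θ => by positivity)]
      · exact integrable_mu (cw.continuous.norm.rpow_const (fun _ => Or.inr (by linarith)))
    rw [e1, e2, I1, enorm_neg, integral_const_mul, enorm_mul,
      Real.enorm_of_nonneg (by linarith : 0 ≤ p - 1), eLpNorm_one_eq_lintegral_enorm]
    gcongr
    exact enorm_integral_le_lintegral_enorm _
  have T1 : ENNReal.HolderTriple (pe m (a + (a + 2))) (ENNReal.ofReal q) 1 := by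
    constructor
    rw [pe, inv_inv, inv_one, ← ENNReal.ofReal_inv_of_pos (by positivity)]
    have hm0 : (0 : ℝ) < 2 * m := by linarith
    have : ((a + (a + 2) : ℕ) : ℝ≥0∞) / ((2 * m : ℕ) : ℝ≥0∞) =
        ENNReal.ofReal ((a + (a + 2)) / (2 * m)) := by
      rw [ENNReal.ofReal_div_of_pos hm0]
      congr 1
      · rw [← ENNReal.ofReal_natCast]; push_cast; rfl
      · rw [← ENNReal.ofReal_natCast]; push_cast; rfl
    rw [this, ← ENNReal.ofReal_add (by positivity) (by positivity), ← ENNReal.ofReal_one]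
    congr 1
    rw [hq, hp]
    have : (2 * m / (a + 1 : ℝ) - 2) ≠ 0 := by rw [← hp]; linarith
    have hmm : (m : ℝ) ≠ 0 := by linarith
    rw [inv_div]
    field_simp
    ring
  have I3 : eLpNorm (fun θ => (v θ * D j w θ) * ‖w θ‖ ^ (p - 2)) 1 (mu d) ≤
      (eLpNorm v (pe m a) (mu d) * eLpNorm (D j w) (pe m (a + 2)) (mu d)) * N ^ (p - 2) := by
    refine (holder (hv.continuous.mul cDw) hcr T1).trans ?_
    refine mul_le_mul' (holder hv.continuous cDw (pe_holder m a (a + 2))) ?_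
    rw [eLpNorm_norm_rpow w hp20, hN, hpe, ← ENNReal.ofReal_mul (by positivity)]
    have : q * (p - 2) = p := by rw [hq]; field_simp
    rw [this]
  have I4 : N ^ 2 * N ^ (p - 2) ≤ (((2 * m : ℕ) : ℝ≥0∞) * (eLpNorm v (pe m a) (mu d) *
      eLpNorm (D j w) (pe m (a + 2)) (mu d))) * N ^ (p - 2) := by
    have e : N ^ 2 * N ^ (p - 2) = N ^ p := by
      rw [← ENNReal.rpow_natCast, ← ENNReal.rpow_add _ _ hN0 hNtop]; norm_num
    rw [e]
    refine I2.trans ?_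
    rw [mul_assoc]
    refine mul_le_mul' ?_ I3
    rw [← ENNReal.ofReal_natCast]
    apply ENNReal.ofReal_le_ofReal
    push_cast
    have : p ≤ 2 * m := by
      rw [hp]; apply div_le_self (by positivity); linarith [(Nat.cast_nonneg a : (0:ℝ) ≤ a)]
    linarith
  have hne0 : N ^ (p - 2) ≠ 0 := by
    simp [ENNReal.rpow_eq_zero_iff, hN0, hNtop]
  have hnetop : N ^ (p - 2) ≠ ⊤ := ENNReal.rpow_ne_top_of_nonneg hp20.le hNtop
  exact (ENNReal.mul_le_mul_iff_left hne0 hnetop).1 I4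

/-- Gagliardo–Nirenberg in one direction. -/
lemma gn {m : ℕ} (hm : m ≠ 0) (j : Fin d) {u : (Fin d → ℝ) → ℝ} (hu : ContDiff ℝ m u)
    (pu : Per d u) {B lam : ℝ≥0} (hl : 1 ≤ lam) (h0 : ∀ θ, |u θ| ≤ B)
    (h1 : eLpNorm ((D j)^[m] u) 2 (mu d) ≤ ((B * lam ^ m : ℝ≥0) : ℝ≥0∞)) :
    Q m j lam m 0 ((2 * m : ℕ) ^ (m * m) * B) u := by
  have hfin : ∀ i ≤ m, eLpNorm ((D j)^[i] u) (pe m i) (mu d) ≠ ⊤ := fun i hi =>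
    eLpNorm_ne_top (Diter_continuous hi j hu) _
  set A : ℕ → ℝ := fun i => (eLpNorm ((D j)^[i] u) (pe m i) (mu d)).toReal with hA
  have key := log_convex m A B (2 * m : ℕ) lam (fun i => ENNReal.toReal_nonneg)
    (by exact_mod_cast (by omega)) (by exact_mod_cast hl)
    (by
      simp only [hA, Function.iterate_zero, id, pe_zero]
      apply ENNReal.toReal_le_of_le_ofReal B.2
      refine (eLpNorm_le_of_ae_bound (C := (B : ℝ)) (Eventually.of_forall h0)).trans ?_
      simp)
    (by
      simp only [hA, pe_self hm]
      apply ENNReal.toReal_le_of_le_ofReal (by positivity)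
      refine h1.trans ?_
      rw [← ENNReal.ofReal_coe_nnreal]; push_cast; exact le_rfl)
    (by
      intro i hi
      have c2 : ContDiff ℝ (2 : ℕ) ((D j)^[i] u) := Diter_contDiff i j (hu.of_le (by norm_cast; omega))
      have := gn_step hi j c2 (pu.Diter j i)
      rw [← Function.iterate_succ_apply' (D j), ← Function.iterate_succ_apply' (D j)] at this
      have h2 := ENNReal.toReal_mono (ENNReal.mul_ne_top (ENNReal.natCast_ne_top _)
        (ENNReal.mul_ne_top (hfin i (by omega)) (hfin (i+2) (by omega)))) this
      simpa [hA] using h2)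
  intro i hi
  have := key i hi
  rw [add_zero, ← ENNReal.ofReal_toReal (hfin i hi), ← ENNReal.ofReal_coe_nnreal]
  apply ENNReal.ofReal_le_ofReal
  push_cast at this ⊢
  exact this

end S15

namespace S15
open Set Filter Topology
open scoped NNReal ENNReal

lemma contDiff_param {E : Type} [NormedAddCommGroup E] [NormedSpace ℝ E] [ProperSpace E]
    (n : ℕ) : ∀ {G : Type} [NormedAddCommGroup G] [NormedSpace ℝ G] [CompleteSpace G]
    {F : E × ℝ → G}, ContDiff ℝ n F →
    ContDiff ℝ n (fun p => ∫ t in (0:ℝ)..1, F (p, t)) := by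
  induction n with
  | zero =>
    intro G _ _ _ F hF
    have hc : Continuous F := hF.continuous
    simp only [CharP.cast_eq_zero]
    rw [contDiff_zero]
    exact intervalIntegral.continuous_parametric_intervalIntegral_of_continuous'
      (f := fun p t => F (p, t)) hc 0 1
  | succ n ih =>
    intro G _ _ _ F hF
    have hF1 : ContDiff ℝ n (fun q : E × ℝ => (fderiv ℝ F q).comp (ContinuousLinearMap.inl ℝ E ℝ)) := by
      have := hF.fderiv_right (m := n) (by norm_cast)
      exact this.clm_comp contDiff_const
    have hcF : Continuous F := hF.continuous
    have hcF1 := hF1.continuous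
    have hd : Differentiable ℝ F := hF.differentiable (by simp)
    push_cast
    rw [contDiff_succ_iff_hasFDerivAt]
    refine ⟨_, ih hF1, ?_⟩
    intro p
    obtain ⟨B, hB⟩ := ((isCompact_closedBall p 1).prod (isCompact_Icc (a := (0:ℝ)) (b := 1))).exists_bound_of_continuousOn
      hcF1.continuousOn
    refine intervalIntegral.hasFDerivAt_integral_of_dominated_of_fderiv_le (𝕜 := ℝ) (μ := volume)
      (F := fun x t => F (x, t))
      (F' := fun x t => (fderiv ℝ F (x, t)).comp (ContinuousLinearMap.inl ℝ E ℝ)) (a := 0) (b := 1)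
      (bound := fun _ => B) (s := Metric.ball p 1) (Metric.ball_mem_nhds p one_pos) ?_ ?_ ?_ ?_ ?_ ?_
    · refine Eventually.of_forall fun x => ?_
      exact (hcF.comp (by fun_prop : Continuous fun t : ℝ => (x, t))).aestronglyMeasurable
    · exact (hcF.comp (by fun_prop : Continuous fun t : ℝ => (p, t))).intervalIntegrable _ _
    · exact (hcF1.comp (by fun_prop : Continuous fun t : ℝ => (p, t))).aestronglyMeasurable
    · refine Eventually.of_forall fun t ht x hx => ?_
      rw [uIoc_of_le zero_le_one] at ht
      exact hB (x, t) ⟨Metric.ball_subset_closedBall hx, ht.1.le, ht.2⟩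
    · exact intervalIntegrable_const
    · refine Eventually.of_forall fun t ht x hx => ?_
      have h1 := (hd (x, t)).hasFDerivAt
      have h2 : HasFDerivAt (fun x : E => (x, t)) (ContinuousLinearMap.inl ℝ E ℝ) x :=
        hasFDerivAt_prodMk_left x t
      exact h1.comp x h2

section
variable {d m : ℕ}

/-- x-derivative -/
noncomputable def dx (f : (Fin d → ℝ) × ℝ → ℝ) : (Fin d → ℝ) × ℝ → ℝ := fun p => fderiv ℝ f p (0, 1)

lemma dx_contDiff {n : ℕ} {f : (Fin d → ℝ) × ℝ → ℝ} (hf : ContDiff ℝ (n + 1 : ℕ) f) :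
    ContDiff ℝ n (dx f) :=
  (hf.fderiv_right (m := n) (by norm_cast)).clm_apply contDiff_const

lemma hasDerivAt_dx {f : (Fin d → ℝ) × ℝ → ℝ} (hf : Differentiable ℝ f) (θ : Fin d → ℝ) (x : ℝ) :
    HasDerivAt (fun x => f (θ, x)) (dx f (θ, x)) x := by
  have h1 := (hf (θ, x)).hasFDerivAt
  have h2 : HasDerivAt (fun x : ℝ => (θ, x)) (0, 1) x :=
    (hasDerivAt_const x θ).prodMk (hasDerivAt_id x)
  exact h1.comp_hasDerivAt x h2

lemma dx_per {f : (Fin d → ℝ) × ℝ → ℝ} (hf : Differentiable ℝ f)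
    (hp : ∀ x : ℝ, Per d (fun θ => f (θ, x))) (x : ℝ) : Per d (fun θ => dx f (θ, x)) := by
  intro p θ
  have h1 := hasDerivAt_dx hf (θ + fun j => 2 * Real.pi * (p j : ℝ)) x
  have h2 := hasDerivAt_dx hf θ x
  have : (fun x => f (θ + fun j => 2 * Real.pi * (p j : ℝ), x)) = fun x => f (θ, x) := by
    ext y; exact hp y p θ
  rw [this] at h1
  exact h1.unique h2

/-- remainder -/
noncomputable def rem (f : (Fin d → ℝ) × ℝ → ℝ) : ES d → ℝ :=
  fun q => f (q.1, q.2.1 + q.2.2) - f (q.1, q.2.1) - dx f (q.1, q.2.1) * q.2.2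

/-- remainder kernel -/
noncomputable def remH (f : (Fin d → ℝ) × ℝ → ℝ) : ES d → ℝ :=
  fun q => ∫ t in (0:ℝ)..1, (1 - t) * dx (dx f) (q.1, q.2.1 + t * q.2.2)

lemma rem_contDiff {f : (Fin d → ℝ) × ℝ → ℝ} (hf : ContDiff ℝ (m + 2 : ℕ) f) :
    ContDiff ℝ m (rem f) := by
  have h0 : ContDiff ℝ m f := hf.of_le (by norm_cast; omega)
  have h1 : ContDiff ℝ m (dx f) := (dx_contDiff (n := m + 1) hf).of_le (by norm_cast; omega)
  unfold rem
  refine ((h0.comp (by fun_prop)).sub (h0.comp (by fun_prop))).sub ((h1.comp (by fun_prop)).mul (by fun_prop))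

lemma remH_contDiff {f : (Fin d → ℝ) × ℝ → ℝ} (hf : ContDiff ℝ (m + 2 : ℕ) f) :
    ContDiff ℝ m (remH f) := by
  have h2 : ContDiff ℝ m (dx (dx f)) := dx_contDiff (n := m) (dx_contDiff (n := m + 1) hf)
  refine contDiff_param m (E := ES d)
    (F := fun q : ES d × ℝ => (1 - q.2) * dx (dx f) (q.1.1, q.1.2.1 + q.2 * q.1.2.2)) ?_
  exact ContDiff.mul (by fun_prop) (h2.comp (by fun_prop))

lemma rem_eq {f : (Fin d → ℝ) × ℝ → ℝ} (hf : ContDiff ℝ (m + 2 : ℕ) f) (q : ES d) :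
    rem f q = remH f q * q.2.2 * q.2.2 := by
  obtain ⟨θ, x, y⟩ := q
  have c1 : ContDiff ℝ (m + 1 : ℕ) (dx f) := dx_contDiff (n := m + 1) hf
  have c2 : ContDiff ℝ m (dx (dx f)) := dx_contDiff c1
  have d0 : Differentiable ℝ f := hf.differentiable (by norm_cast)
  have d1 : Differentiable ℝ (dx f) := c1.differentiable (by norm_cast)
  have hl : ∀ t : ℝ, HasDerivAt (fun t : ℝ => x + t * y) y t := fun t => by
    simpa using ((hasDerivAt_id t).mul_const y).const_add x
  have key : ∀ t : ℝ, HasDerivAt (fun t => f (θ, x + t * y) + (1 - t) * (dx f (θ, x + t * y) * y))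
      ((1 - t) * dx (dx f) (θ, x + t * y) * (y * y)) t := by
    intro t
    have h0 := (hasDerivAt_dx d0 θ (x + t * y)).comp t (hl t)
    have h1 := ((hasDerivAt_dx d1 θ (x + t * y)).comp t (hl t)).mul_const y
    have h2 : HasDerivAt (fun t : ℝ => 1 - t) (-1) t := by simpa using (hasDerivAt_id t).const_sub 1
    have h3 := h0.add (h2.mul h1)
    refine h3.congr_deriv ?_
    simp only [Function.comp]
    ring
  have hcont : Continuous fun t : ℝ => (1 - t) * dx (dx f) (θ, x + t * y) :=
    Continuous.mul (by fun_prop) (c2.continuous.comp (by fun_prop))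
  have := intervalIntegral.integral_eq_sub_of_hasDerivAt (a := 0) (b := 1) (fun t _ => key t)
    ((hcont.mul continuous_const).intervalIntegrable _ _)
  rw [intervalIntegral.integral_mul_const] at this
  simp only [rem, remH]
  rw [mul_assoc, this]
  simp
  ring

lemma rem_per {f : (Fin d → ℝ) × ℝ → ℝ} (hf : Differentiable ℝ f)
    (hp : ∀ x : ℝ, Per d (fun θ => f (θ, x))) {V W : (Fin d → ℝ) → ℝ} (pV : Per d V) (pW : Per d W) :
    Per d (cmp (rem f) V W) := by
  intro p θ
  have h1 := fun x => hp x p θ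
  have h2 := fun x => dx_per hf hp x p θ
  simp only [cmp, rem, pV p θ, pW p θ]
  simp only at h1 h2
  rw [h1, h1, h2]

end
end S15

namespace S15
open Set Filter Topology
open scoped NNReal ENNReal

section
variable {d m : ℕ}

lemma eLpNorm_two {f : (Fin d → ℝ) → ℝ} (hf : Continuous f) :
    eLpNorm f 2 (mu d) = ENNReal.ofReal (Real.sqrt (∫ θ, f θ ^ 2 ∂(mu d))) := by
  have hm : MemLp f 2 (mu d) := ⟨hf.aestronglyMeasurable, (eLpNorm_ne_top hf 2).lt_top⟩
  rw [hm.eLpNorm_eq_integral_rpow_norm (by simp) (by simp), Real.sqrt_eq_rpow]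
  simp

lemma weight_le (hm : m ≠ 0) (k : Fin d → ℤ) :
    (1 + ∑ j, ((k j : ℝ))^2) ^ (m : ℝ) ≤
      ((d : ℝ) + 1) ^ (m - 1) * (1 + ∑ j, |(k j : ℝ)| ^ (2 * m)) := by
  rw [Real.rpow_natCast]
  obtain ⟨n, rfl⟩ := Nat.exists_eq_succ_of_ne_zero hm
  have := pow_sum_div_card_le_sum_pow (s := (Finset.univ : Finset (Option (Fin d))))
    (f := fun o : Option (Fin d) => o.elim (1:ℝ) (fun j => (k j : ℝ)^2)) (n := n) (by
      intro o _
      cases o <;> simp [sq_nonneg])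
  rw [Fintype.sum_option, Fintype.sum_option] at this
  simp only [Option.elim_none, Option.elim_some, one_pow, Finset.card_univ, Fintype.card_option, Fintype.card_fin] at this
  push_cast at this
  rw [div_le_iff₀ (by positivity)] at this
  simp only [Nat.succ_eq_add_one, Nat.add_sub_cancel]
  rw [mul_comm]
  refine this.trans_eq ?_
  congr 2
  refine Finset.sum_congr rfl fun j _ => ?_
  rw [pow_mul, sq_abs]

lemma le_weight (k : Fin d → ℤ) (j : Fin d) :
    |(k j : ℝ)| ^ (2 * m) ≤ (1 + ∑ j, ((k j : ℝ))^2) ^ (m : ℝ) := by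
  rw [Real.rpow_natCast, pow_mul, sq_abs]
  refine pow_le_pow_left₀ (sq_nonneg _) ?_ _
  have := Finset.single_le_sum (f := fun j => ((k j : ℝ))^2) (fun i _ => sq_nonneg _) (Finset.mem_univ j)
  linarith

lemma fin_sum_bound (hm : m ≠ 0) {F : (Fin d → ℝ) → ℝ} (hF : ContDiff ℝ m F) (pF : Per d F)
    {A : ℝ≥0} (h0 : eLpNorm F 2 (mu d) ≤ A) (h1 : ∀ j, eLpNorm ((D j)^[m] F) 2 (mu d) ≤ A)
    (S : Finset (Fin d → ℤ)) :
    ∑ k ∈ S, ‖fcoef d F k‖^2 * (1 + ∑ j, ((k j : ℝ))^2) ^ (m : ℝ) ≤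
      ((d : ℝ) + 1) ^ m * (A : ℝ) ^ 2 := by
  have sq : ∀ f : (Fin d → ℝ) → ℝ, Continuous f → eLpNorm f 2 (mu d) ≤ A →
      ∫ θ, f θ ^ 2 ∂(mu d) ≤ (A : ℝ) ^ 2 := by
    intro f hf h
    rw [eLpNorm_two hf, ENNReal.ofReal_le_iff_le_toReal (by simp), ENNReal.coe_toReal] at h
    exact (Real.sqrt_le_left A.2).1 h
  have e0 := (sum_le_hasSum S (fun k _ => by positivity) (plancherel_real hF.continuous pF)).trans
    (sq _ hF.continuous h0)
  have e1 := fun j => (sum_le_hasSum S (fun k _ => by positivity) (plancherel_Diter j m hF pF)).trans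
    (sq _ (Diter_continuous le_rfl j hF) (h1 j))
  calc _ ≤ ∑ k ∈ S, ((d : ℝ) + 1) ^ (m - 1) * (‖fcoef d F k‖^2 +
        ∑ j, |(k j : ℝ)| ^ (2 * m) * ‖fcoef d F k‖^2) := by
        refine Finset.sum_le_sum fun k _ => ?_
        calc _ ≤ ‖fcoef d F k‖^2 * (((d : ℝ) + 1) ^ (m - 1) * (1 + ∑ j, |(k j : ℝ)| ^ (2 * m))) := by
              gcongr; exact weight_le hm k
          _ = _ := by rw [← Finset.sum_mul]; ring
    _ = ((d : ℝ) + 1) ^ (m - 1) * (∑ k ∈ S, ‖fcoef d F k‖^2 +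
        ∑ j, ∑ k ∈ S, |(k j : ℝ)| ^ (2 * m) * ‖fcoef d F k‖^2) := by
        rw [← Finset.mul_sum, Finset.sum_add_distrib, Finset.sum_comm]
    _ ≤ ((d : ℝ) + 1) ^ (m - 1) * ((A : ℝ) ^ 2 + ∑ j : Fin d, (A : ℝ) ^ 2) := by
        gcongr with j; exact e1 j
    _ = _ := by
        obtain ⟨n, rfl⟩ := Nat.exists_eq_succ_of_ne_zero hm
        simp
        ring

lemma Diter_le_sob {V : (Fin d → ℝ) → ℝ} (hV : ContDiff ℝ m V) (pV : Per d V) (j : Fin d)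
    {a : ℝ≥0} (ha : ∀ S : Finset (Fin d → ℤ),
      ∑ k ∈ S, ‖fcoef d V k‖^2 * (1 + ∑ j, ((k j : ℝ))^2) ^ (m : ℝ) ≤ (a : ℝ) ^ 2) :
    eLpNorm ((D j)^[m] V) 2 (mu d) ≤ a := by
  rw [eLpNorm_two (Diter_continuous le_rfl j hV), ENNReal.ofReal_le_iff_le_toReal (by simp),
    ENNReal.coe_toReal]
  refine (Real.sqrt_le_left a.2).2 ?_
  refine hasSum_le_of_sum_le (plancherel_Diter j m hV pV) fun S => ?_
  refine (Finset.sum_le_sum fun k _ => ?_).trans (ha S)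
  rw [mul_comm]
  gcongr
  exact le_weight k j

lemma apriori (hm : m ≠ 0) {f : (Fin d → ℝ) × ℝ → ℝ} (hf : ContDiff ℝ (m + 2 : ℕ) f) (j : Fin d)
    (R CS : ℝ≥0) : ∃ C : ℝ≥0, ∀ V W : (Fin d → ℝ) → ℝ, ContDiff ℝ m V → ContDiff ℝ m W →
      Per d V → Per d W → (∀ θ, |V θ| ≤ R) → (∀ θ, |W θ| ≤ R) → ∀ a ε : ℝ≥0,
      eLpNorm ((D j)^[m] V) 2 (mu d) ≤ a → eLpNorm ((D j)^[m] W) 2 (mu d) ≤ ε →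
      (∀ θ, |W θ| ≤ CS * ε) →
      eLpNorm ((D j)^[m] (cmp (rem f) V W)) 2 (mu d) ≤ ((C * (1 + a) * ε ^ 2 : ℝ≥0) : ℝ≥0∞) := by
  set N : ℝ≥0 := (2*m:ℕ)^(m*m) with hN
  set K : ℝ≥0 := N * (R + 1) with hK
  obtain ⟨C1, hC1⟩ := comp_est m j R K m le_rfl (rem f) (rem_contDiff hf)
  obtain ⟨C2, hC2⟩ := comp_est m j R K m le_rfl (remH f) (remH_contDiff hf)
  set C3 : ℝ≥0 := 2 ^ m * (2 ^ m * C2 * (N * (CS + 1))) * (N * (CS + 1)) with hC3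
  refine ⟨2 * C1 + 2 * C3, ?_⟩
  intro V W cV cW pV pW bV bW a ε hVa hWe hWS
  set lam : ℝ≥0 := (1 + a + ε) ^ ((m : ℝ)⁻¹) with hlam
  have hlm : lam ^ m = 1 + a + ε := by
    rw [hlam, ← NNReal.rpow_natCast, ← NNReal.rpow_mul, inv_mul_cancel₀ (by exact_mod_cast hm), NNReal.rpow_one]
  have hl1 : 1 ≤ lam := by
    apply NNReal.one_le_rpow
    · rw [add_assoc]; exact le_self_add
    · positivity
  have gV : Q m j lam m 0 K V := by
    refine gn hm j cV pV hl1 (fun θ => (bV θ).trans ?_) (hVa.trans ?_)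
    · push_cast; linarith
    · rw [hlm]; norm_cast
      calc a ≤ 1 * (1 + a + ε) := by rw [one_mul, add_comm 1 a, add_assoc]; exact le_self_add
        _ ≤ _ := by gcongr; exact le_add_self
  have gW : Q m j lam m 0 K W := by
    refine gn hm j cW pW hl1 (fun θ => (bW θ).trans ?_) (hWe.trans ?_)
    · push_cast; linarith
    · rw [hlm]; norm_cast
      calc ε ≤ 1 * (1 + a + ε) := by rw [one_mul]; exact le_add_self
        _ ≤ _ := by gcongr; exact le_add_self
  rcases le_total ε 1 with h | h
  · have gW' : Q m j lam m 0 (N * ((CS + 1) * ε)) W := by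
      refine gn hm j cW pW hl1 (fun θ => (hWS θ).trans ?_) (hWe.trans ?_)
      · push_cast; nlinarith [ε.2]
      · rw [hlm]; norm_cast
        calc ε = 1 * ε * 1 := by simp
          _ ≤ (CS + 1) * ε * (1 + a + ε) := by
            gcongr
            · exact le_add_self
            · rw [add_assoc]; exact le_self_add
    have q1 := hC2 lam hl1 V W cV cW bV bW gV gW
    have cH := cmp_contDiff (remH_contDiff hf) cV cW
    have q2 := Q.mul (s := 0) (s' := 0) (by omega) q1 gW' cH cW
    have q3 := Q.mul (s := 0) (s' := 0) (by omega) q2 gW' (cH.mul cW) cW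
    have e : (fun θ => cmp (remH f) V W θ * W θ * W θ) = cmp (rem f) V W := by
      ext θ
      simp only [cmp, rem_eq hf]
    rw [e] at q3
    have := q3 m le_rfl
    simp only [add_zero] at this
    rw [pe_self hm, hlm] at this
    refine this.trans ?_
    norm_cast
    calc _ = C3 * ε ^ 2 * (1 + a + ε) := by rw [hC3]; push_cast; ring
      _ ≤ C3 * ε ^ 2 * (2 * (1 + a)) := by
        gcongr
        calc 1 + a + ε ≤ 1 + a + (1 + a) := by gcongr; exact h.trans le_self_add
          _ = _ := by ring
      _ = 2 * C3 * (1 + a) * ε ^ 2 := by ring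
      _ ≤ _ := by gcongr; exact le_add_self
  · have := hC1 lam hl1 V W cV cW bV bW gV gW m le_rfl
    simp only [add_zero] at this
    rw [pe_self hm, hlm] at this
    refine this.trans ?_
    norm_cast
    calc _ ≤ C1 * (2 * (1 + a) * ε ^ 2) := by
          gcongr
          rw [← NNReal.coe_le_coe]
          have h' : (1 : ℝ) ≤ ε := by exact_mod_cast h
          push_cast
          nlinarith [a.2, mul_nonneg a.2 (sq_nonneg ((ε:ℝ))), sq_nonneg ((ε:ℝ) - 1), mul_nonneg a.2 (by nlinarith : 0 ≤ (ε:ℝ)^2 - 1)]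
      _ = 2 * C1 * (1 + a) * ε ^ 2 := by ring
      _ ≤ _ := by gcongr; exact le_self_add

lemma sup_est {f : (Fin d → ℝ) × ℝ → ℝ} (hf : ContDiff ℝ (m + 2 : ℕ) f)
    (R CS : ℝ≥0) : ∃ C : ℝ≥0, ∀ V W : (Fin d → ℝ) → ℝ, ContDiff ℝ m V → ContDiff ℝ m W →
      (∀ θ, |V θ| ≤ R) → (∀ θ, |W θ| ≤ R) → ∀ ε : ℝ≥0,
      (∀ θ, |W θ| ≤ CS * ε) →
      eLpNorm (cmp (rem f) V W) 2 (mu d) ≤ ((C * ε ^ 2 : ℝ≥0) : ℝ≥0∞) := by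
  have hc : IsCompact (cell d ×ˢ (Icc (-(R : ℝ)) R ×ˢ Icc (-(R : ℝ)) R)) :=
    (isCompact_cell d).prod (isCompact_Icc.prod isCompact_Icc)
  obtain ⟨B, hB⟩ := hc.exists_bound_of_continuousOn (remH_contDiff hf).continuous.continuousOn
  refine ⟨B.toNNReal * CS ^ 2, ?_⟩
  intro V W cV cW bV bW ε hW
  have := eLpNorm_le_of_ae_bound (μ := mu d) (p := 2) (f := cmp (rem f) V W)
    (C := ((B.toNNReal * CS ^ 2 * ε ^ 2 : ℝ≥0) : ℝ)) (by
      filter_upwards [ae_mu_cell d] with θ hθ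
      have h1 := hB (θ, V θ, W θ) ⟨hθ, abs_le.1 (bV θ), abs_le.1 (bW θ)⟩
      have h2 : ‖remH f (θ, V θ, W θ)‖ ≤ B.toNNReal := h1.trans (Real.le_coe_toNNReal B)
      simp only [cmp, rem_eq hf]
      rw [norm_mul, norm_mul, Real.norm_eq_abs (W θ)]
      push_cast
      calc _ ≤ (B.toNNReal : ℝ) * (CS * ε) * (CS * ε) := by
            gcongr
            · exact hW θ
            · exact hW θ
        _ = _ := by ring)
  rw [ENNReal.ofReal_coe_nnreal] at this
  simpa using this

/-- the a priori estimate for regular functions -/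
lemma apriori_sum (hm : m ≠ 0) {f : (Fin d → ℝ) × ℝ → ℝ} (hf : ContDiff ℝ (m + 2 : ℕ) f)
    (hp : ∀ x : ℝ, Per d (fun θ => f (θ, x)))
    (R CS : ℝ≥0) : ∃ C : ℝ≥0, ∀ V W : (Fin d → ℝ) → ℝ, ContDiff ℝ m V → ContDiff ℝ m W →
      Per d V → Per d W → (∀ θ, |V θ| ≤ R) → (∀ θ, |W θ| ≤ R) → ∀ a ε : ℝ≥0,
      (∀ S : Finset (Fin d → ℤ),
        ∑ k ∈ S, ‖fcoef d V k‖^2 * (1 + ∑ j, ((k j : ℝ))^2) ^ (m : ℝ) ≤ (a : ℝ) ^ 2) →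
      (∀ S : Finset (Fin d → ℤ),
        ∑ k ∈ S, ‖fcoef d W k‖^2 * (1 + ∑ j, ((k j : ℝ))^2) ^ (m : ℝ) ≤ (ε : ℝ) ^ 2) →
      (∀ θ, |W θ| ≤ CS * ε) →
      ∀ S : Finset (Fin d → ℤ),
        ∑ k ∈ S, ‖fcoef d (cmp (rem f) V W) k‖^2 * (1 + ∑ j, ((k j : ℝ))^2) ^ (m : ℝ) ≤
          ((C : ℝ) * (1 + a) * ε ^ 2) ^ 2 := by
  choose C hC using fun j => apriori hm hf j R CS
  obtain ⟨C0, hC0⟩ := sup_est hf R CS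
  set B : ℝ≥0 := C0 + ∑ j, C j with hB
  refine ⟨((d:ℝ≥0) + 1) ^ m * B, ?_⟩
  intro V W cV cW pV pW bV bW a ε ha he hWS S
  have hd : Differentiable ℝ f := hf.differentiable (by norm_cast)
  refine (fin_sum_bound hm (cmp_contDiff (rem_contDiff hf) cV cW) (rem_per hd hp pV pW)
    (A := B * (1 + a) * ε ^ 2) ?_ ?_ S).trans ?_
  · refine (hC0 V W cV cW bV bW ε hWS).trans ?_
    norm_cast
    gcongr
    calc C0 = C0 * 1 := by simp
      _ ≤ B * (1 + a) := by gcongr <;> exact le_self_add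
  · intro j
    refine (hC j V W cV cW pV pW bV bW a ε (Diter_le_sob cV pV j ha) (Diter_le_sob cW pW j he) hWS).trans ?_
    norm_cast
    gcongr
    exact (Finset.single_le_sum (f := C) (fun _ _ => zero_le) (Finset.mem_univ j)).trans le_add_self
  · push_cast
    have : (1:ℝ) ≤ ((d:ℝ)+1)^m := one_le_pow₀ (by linarith [(Nat.cast_nonneg d : (0:ℝ) ≤ d)])
    have h2 : ((d:ℝ)+1)^m ≤ (((d:ℝ)+1)^m)^2 := by nlinarith
    calc _ ≤ (((d:ℝ)+1)^m)^2 * ((B:ℝ) * (1 + a) * ε ^ 2) ^ 2 := by gcongr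
      _ = _ := by ring

end
end S15

namespace S15
open Set Filter Topology
open scoped NNReal ENNReal

section
variable {d m : ℕ}

lemma summable_weight (hm : d < 2 * m) :
    Summable (fun k : Fin d → ℤ => ((1 + ∑ j, ((k j : ℝ))^2) ^ (m : ℝ))⁻¹) := by
  let L : Submodule ℤ (Fin d → ℝ) := Submodule.span ℤ (Set.range (Pi.basisFun ℝ (Fin d)))
  have hr : Module.finrank ℤ L = d := by
    rw [ZLattice.rank ℝ L]; simp
  have hs := ZLattice.summable_norm_pow_inv L (2 * m) (by rw [hr]; exact hm)
  have hmem : ∀ k : Fin d → ℤ, (fun j => (k j : ℝ)) ∈ L := by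
    intro k
    have : (fun j => (k j : ℝ)) = ∑ j, k j • (Pi.basisFun ℝ (Fin d)) j := by
      ext i
      simp [Finset.sum_apply, Pi.single_apply]
    rw [this]
    exact Submodule.sum_mem _ fun j _ => Submodule.smul_mem _ _ (Submodule.subset_span ⟨j, rfl⟩)
  let i : (Fin d → ℤ) → L := fun k => ⟨fun j => (k j : ℝ), hmem k⟩
  have hi : Function.Injective i := by
    intro k l h
    have := congrArg Subtype.val h
    ext j
    have := congrFun this j
    simpa [i] using this
  refine Summable.of_norm_bounded_eventually (hs.comp_injective hi) ?_
  rw [Filter.eventually_cofinite]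
  refine (Set.finite_singleton (0 : Fin d → ℤ)).subset ?_
  intro k hk
  by_contra hk0
  apply hk
  rw [Set.mem_singleton_iff] at hk0
  have hpos : 0 < ‖(fun j => (k j : ℝ) : Fin d → ℝ)‖ := by
    rw [norm_pos_iff]
    intro h
    apply hk0
    ext j
    simpa using congrFun h j
  have hle : ‖(fun j => (k j : ℝ) : Fin d → ℝ)‖ ≤ Real.sqrt (1 + ∑ j, ((k j : ℝ))^2) := by
    rw [pi_norm_le_iff_of_nonneg (Real.sqrt_nonneg _)]
    intro j
    apply Real.abs_le_sqrt
    have := Finset.single_le_sum (f := fun j => ((k j : ℝ))^2) (fun i _ => sq_nonneg _) (Finset.mem_univ j)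
    linarith
  have h0 : 0 ≤ 1 + ∑ j, ((k j : ℝ))^2 := by positivity
  rw [Real.norm_of_nonneg (by positivity), Real.rpow_natCast]
  change _ ≤ ‖(fun j => (k j : ℝ) : Fin d → ℝ)‖⁻¹ ^ (2 * m)
  rw [inv_pow]
  gcongr
  rw [pow_mul]
  gcongr
  calc _ ≤ (Real.sqrt (1 + ∑ j, ((k j : ℝ))^2)) ^ 2 := by gcongr
    _ = _ := Real.sq_sqrt h0

lemma sobolev (hm : d < 2 * m) : ∃ CS : ℝ≥0, ∀ V : (Fin d → ℝ) → ℝ, Continuous V → Per d V →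
    ∀ a : ℝ≥0, (∀ S : Finset (Fin d → ℤ),
      ∑ k ∈ S, ‖fcoef d V k‖^2 * (1 + ∑ j, ((k j : ℝ))^2) ^ (m : ℝ) ≤ (a : ℝ) ^ 2) →
    Summable (fun k => ‖fcoef d V k‖) ∧ ∀ θ, |V θ| ≤ CS * a := by
  have hs := summable_weight hm
  set T := ∑' k : Fin d → ℤ, ((1 + ∑ j, ((k j : ℝ))^2) ^ (m : ℝ))⁻¹ with hT
  refine ⟨NNReal.sqrt T.toNNReal, ?_⟩
  have hT0 : 0 ≤ T := tsum_nonneg fun k => by positivity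
  intro V cV pV a ha
  have hCS : ((NNReal.sqrt T.toNNReal : ℝ≥0) : ℝ) = Real.sqrt T := by
    rw [Real.coe_sqrt, Real.coe_toNNReal _ hT0]
  have key : ∀ S : Finset (Fin d → ℤ), ∑ k ∈ S, ‖fcoef d V k‖ ≤ Real.sqrt T * a := by
    intro S
    have hw : ∀ k : Fin d → ℤ, 0 < (1 + ∑ j, ((k j : ℝ))^2) ^ (m : ℝ) := fun k => by positivity
    have h := Real.sum_mul_le_sqrt_mul_sqrt S
      (fun k => ‖fcoef d V k‖ * Real.sqrt ((1 + ∑ j, ((k j : ℝ))^2) ^ (m : ℝ)))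
      (fun k => (Real.sqrt ((1 + ∑ j, ((k j : ℝ))^2) ^ (m : ℝ)))⁻¹)
    have e1 : ∀ k : Fin d → ℤ, ‖fcoef d V k‖ * Real.sqrt ((1 + ∑ j, ((k j : ℝ))^2) ^ (m : ℝ)) *
        (Real.sqrt ((1 + ∑ j, ((k j : ℝ))^2) ^ (m : ℝ)))⁻¹ = ‖fcoef d V k‖ := by
      intro k
      rw [mul_assoc, mul_inv_cancel₀ (Real.sqrt_pos.2 (hw k)).ne', mul_one]
    simp only [e1, mul_pow, inv_pow, Real.sq_sqrt (hw _).le] at h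
    refine h.trans ?_
    rw [mul_comm]
    gcongr
    · exact hs.sum_le_tsum S (fun k _ => by positivity)
    · exact (Real.sqrt_le_left a.2).2 (ha S)
  have hsum : Summable (fun k => ‖fcoef d V k‖) := summable_of_sum_le (fun _ => norm_nonneg _) key
  refine ⟨hsum, fun θ => ?_⟩
  have hc : cfc d (fun θ => (V θ : ℂ)) = fcoef d V := by ext k; rw [fcoef_eq]
  have hinv := inversion (fun θ => (V θ : ℂ)) (by fun_prop) (fun p θ => by simp only [pV p θ])
    (by rw [hc]; exact hsum.of_norm) θ
  rw [hc] at hinv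
  rw [hCS, ← Real.norm_eq_abs, ← Complex.norm_real]
  have hn : ∀ k, ‖fcoef d V k * ee k θ‖ = ‖fcoef d V k‖ := fun k => by rw [norm_mul, norm_ee, mul_one]
  rw [← hinv.tsum_eq]
  refine (norm_tsum_le_tsum_norm (by simpa only [hn] using hsum)).trans ?_
  simp only [hn]
  exact hsum.tsum_le_of_sum_le key

/-- truncation -/
noncomputable def trunc (V : (Fin d → ℝ) → ℝ) (S : Finset (Fin d → ℤ)) (θ : Fin d → ℝ) : ℝ :=
  (∑ k ∈ S, fcoef d V k * ee k θ).re

lemma trunc_contDiff (V : (Fin d → ℝ) → ℝ) (S : Finset (Fin d → ℤ)) {n} :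
    ContDiff ℝ n (trunc V S) := by
  have : ContDiff ℝ n (fun θ => ∑ k ∈ S, fcoef d V k * ee k θ) :=
    ContDiff.sum fun k _ => contDiff_const.mul (contDiff_ee k)
  exact Complex.reCLM.contDiff.comp this

lemma trunc_per (V : (Fin d → ℝ) → ℝ) (S : Finset (Fin d → ℤ)) : Per d (trunc V S) := by
  intro p θ
  simp only [trunc, per_ee _ p θ]

lemma ee_neg (k : Fin d → ℤ) (θ) : ee (-k) θ = (starRingEnd ℂ) (ee k θ) := by
  unfold ee
  rw [← Complex.exp_conj]
  simp [Finset.sum_neg_distrib]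

lemma cfc_conj (u : (Fin d → ℝ) → ℂ) (k : Fin d → ℤ) :
    cfc d (fun θ => (starRingEnd ℂ) (u θ)) k = (starRingEnd ℂ) (cfc d u (-k)) := by
  unfold cfc
  rw [← integral_conj]
  congr 1
  ext θ
  rw [map_mul, ← ee_neg, neg_neg (-k)]

lemma fcoef_neg (V : (Fin d → ℝ) → ℝ) (k : Fin d → ℤ) :
    fcoef d V (-k) = (starRingEnd ℂ) (fcoef d V k) := by
  rw [fcoef_eq, fcoef_eq]
  have := cfc_conj (fun θ => (V θ : ℂ)) (-k)
  simp only [Complex.conj_ofReal, neg_neg] at this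
  exact this

lemma fcoef_trunc (V : (Fin d → ℝ) → ℝ) (S : Finset (Fin d → ℤ)) (k : Fin d → ℤ) :
    ‖fcoef d (trunc V S) k‖ ≤ ‖fcoef d V k‖ := by
  classical
  set U : (Fin d → ℝ) → ℂ := fun θ => ∑ k ∈ S, fcoef d V k * ee k θ with hU
  have cU : Continuous U := continuous_finsetSum _ fun k _ => continuous_const.mul (continuous_ee k)
  have h1 : ∀ k, cfc d U k = if k ∈ S then fcoef d V k else 0 := by
    intro k
    unfold cfc
    simp only [hU, Finset.sum_mul]
    have hi : ∀ l ∈ S, Integrable (fun θ => fcoef d V l * ee l θ * ee (-k) θ) (mu d) := fun l _ =>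
      integrable_mu ((continuous_const.mul (continuous_ee l)).mul (continuous_ee _))
    rw [integral_finsetSum _ hi]
    have : ∀ l, ∫ θ, fcoef d V l * ee l θ * ee (-k) θ ∂(mu d) = if k = l then fcoef d V l else 0 := by
      intro l
      have := cfc_ee k l
      unfold cfc at this
      simp only [mul_assoc]
      rw [integral_const_mul, this]
      split_ifs <;> simp
    simp only [this]
    rw [Finset.sum_ite_eq]
  have h2 : fcoef d (trunc V S) k = (cfc d U k + (starRingEnd ℂ) (cfc d U (-k))) / 2 := by
    rw [← cfc_conj, fcoef_eq]
    unfold cfc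
    have i1 : Integrable (fun θ => U θ * ee (-k) θ) (mu d) :=
      integrable_mu (cU.mul (continuous_ee _))
    have i2 : Integrable (fun θ => (starRingEnd ℂ) (U θ) * ee (-k) θ) (mu d) :=
      integrable_mu ((Complex.continuous_conj.comp cU).mul (continuous_ee _))
    rw [← integral_add i1 i2, ← integral_div]
    congr 1
    ext θ
    have : ((trunc V S θ : ℝ) : ℂ) = (U θ + (starRingEnd ℂ) (U θ)) / 2 := by
      rw [Complex.add_conj]
      simp [trunc, hU]
    simp only [this]
    ring
  rw [h2, h1, h1, norm_div]
  have e1 : ‖if k ∈ S then fcoef d V k else 0‖ ≤ ‖fcoef d V k‖ := by split_ifs <;> simp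
  have e2 : ‖(starRingEnd ℂ) (if -k ∈ S then fcoef d V (-k) else 0)‖ ≤ ‖fcoef d V k‖ := by
    rw [fcoef_neg]
    split_ifs <;> simp
  have := (norm_add_le _ _).trans (add_le_add e1 e2)
  rw [div_le_iff₀ (by simp)]
  refine this.trans_eq ?_
  simp; ring

lemma trunc_tendsto {V : (Fin d → ℝ) → ℝ} (cV : Continuous V) (pV : Per d V)
    (hs : Summable (fun k => ‖fcoef d V k‖)) : TendstoUniformly (trunc V) V atTop := by
  have hc : cfc d (fun θ => (V θ : ℂ)) = fcoef d V := by ext k; rw [fcoef_eq]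
  have hinv := fun θ => inversion (fun θ => (V θ : ℂ)) (by fun_prop) (fun p θ => by simp only [pV p θ])
    (by rw [hc]; exact hs.of_norm) θ
  rw [hc] at hinv
  have h := tendstoUniformly_tsum hs (f := fun k θ => fcoef d V k * ee k θ)
    (fun k θ => by rw [norm_mul, norm_ee, mul_one])
  rw [Metric.tendstoUniformly_iff] at h ⊢
  intro ε hε
  filter_upwards [h ε hε] with S hS θ
  refine lt_of_le_of_lt ?_ (hS θ)
  rw [(hinv θ).tsum_eq, dist_eq_norm, dist_eq_norm, trunc, Real.norm_eq_abs]
  refine le_trans (le_of_eq ?_) (Complex.abs_re_le_norm _)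
  simp

lemma sum_trunc_le {V : (Fin d → ℝ) → ℝ} {a : ℝ≥0} (ha : ∀ S : Finset (Fin d → ℤ),
      ∑ k ∈ S, ‖fcoef d V k‖^2 * (1 + ∑ j, ((k j : ℝ))^2) ^ (m : ℝ) ≤ (a : ℝ) ^ 2)
    (T S : Finset (Fin d → ℤ)) :
      ∑ k ∈ S, ‖fcoef d (trunc V T) k‖^2 * (1 + ∑ j, ((k j : ℝ))^2) ^ (m : ℝ) ≤ (a : ℝ) ^ 2 := by
  refine le_trans (Finset.sum_le_sum fun k _ => ?_) (ha S)
  gcongr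
  exact fcoef_trunc V T k

lemma fcoef_tendsto {G : ES d → ℝ} (hG : Continuous G) {V W : (Fin d → ℝ) → ℝ} {R : ℝ}
    (hV : TendstoUniformly (trunc V) V atTop) (hW : TendstoUniformly (trunc W) W atTop)
    (bV : ∀ᶠ S in atTop, ∀ θ, |trunc V S θ| ≤ R) (bW : ∀ᶠ S in atTop, ∀ θ, |trunc W S θ| ≤ R)
    (k : Fin d → ℤ) :
    Tendsto (fun S => fcoef d (cmp G (trunc V S) (trunc W S)) k) atTop
      (𝓝 (fcoef d (cmp G V W) k)) := by
  simp only [fcoef_eq]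
  unfold cfc
  have hc : IsCompact (cell d ×ˢ (Icc (-(R : ℝ)) R ×ˢ Icc (-(R : ℝ)) R)) :=
    (isCompact_cell d).prod (isCompact_Icc.prod isCompact_Icc)
  obtain ⟨B, hB⟩ := hc.exists_bound_of_continuousOn hG.continuousOn
  refine tendsto_integral_filter_of_dominated_convergence (fun _ => B) ?_ ?_ (integrable_const _) ?_
  · refine Eventually.of_forall fun S => Continuous.aestronglyMeasurable ?_
    refine Continuous.mul ?_ (continuous_ee _)
    refine Complex.continuous_ofReal.comp (hG.comp ?_)
    exact continuous_id.prodMk ((trunc_contDiff (n := 0) V S).continuous.prodMk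
      (trunc_contDiff (n := 0) W S).continuous)
  · filter_upwards [bV, bW] with S h1 h2
    filter_upwards [ae_mu_cell d] with θ hθ
    rw [norm_mul, norm_ee, mul_one, Complex.norm_real]
    exact hB (θ, _, _) ⟨hθ, abs_le.1 (h1 θ), abs_le.1 (h2 θ)⟩
  · refine Eventually.of_forall fun θ => ?_
    refine Tendsto.mul_const _ ?_
    refine (Complex.continuous_ofReal.tendsto _).comp ?_
    refine (hG.tendsto (θ, V θ, W θ)).comp ?_
    exact tendsto_const_nhds.prodMk_nhds
      ((hV.tendsto_at θ).prodMk_nhds (hW.tendsto_at θ))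

lemma bound_trunc {V : (Fin d → ℝ) → ℝ} {R : ℝ} (hV : TendstoUniformly (trunc V) V atTop)
    (h : ∀ θ, |V θ| ≤ R) : ∀ᶠ S in atTop, ∀ θ, |trunc V S θ| ≤ R + 1 := by
  filter_upwards [Metric.tendstoUniformly_iff.1 hV 1 one_pos] with S hS θ
  have h1 := hS θ
  rw [Real.dist_eq] at h1
  have h2 := h θ
  rw [abs_le] at h2 ⊢
  rw [abs_lt] at h1
  constructor <;> linarith

lemma main (hm : d < 2 * m) {f : (Fin d → ℝ) × ℝ → ℝ} (hf : ContDiff ℝ (m + 2 : ℕ) f)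
    (hp : ∀ x : ℝ, Per d (fun θ => f (θ, x))) (R : ℝ≥0) :
    ∃ C : ℝ≥0, ∀ V W : (Fin d → ℝ) → ℝ, Continuous V → Continuous W →
      Per d V → Per d W → (∀ θ, |V θ| ≤ R) → (∀ θ, |W θ| ≤ R) → ∀ a ε : ℝ≥0,
      (∀ S : Finset (Fin d → ℤ),
        ∑ k ∈ S, ‖fcoef d V k‖^2 * (1 + ∑ j, ((k j : ℝ))^2) ^ (m : ℝ) ≤ (a : ℝ) ^ 2) →
      (∀ S : Finset (Fin d → ℤ),
        ∑ k ∈ S, ‖fcoef d W k‖^2 * (1 + ∑ j, ((k j : ℝ))^2) ^ (m : ℝ) ≤ (ε : ℝ) ^ 2) →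
      ∀ S : Finset (Fin d → ℤ),
        ∑ k ∈ S, ‖fcoef d (cmp (rem f) V W) k‖^2 * (1 + ∑ j, ((k j : ℝ))^2) ^ (m : ℝ) ≤
          ((C : ℝ) * (1 + a) * ε ^ 2) ^ 2 := by
  obtain ⟨CS, hCS⟩ := sobolev hm
  obtain ⟨C, hC⟩ := apriori_sum (by omega) hf hp (R + 1) CS
  refine ⟨C, ?_⟩
  intro V W cV cW pV pW bV bW a ε ha he S
  have uV := trunc_tendsto cV pV (hCS V cV pV a ha).1
  have uW := trunc_tendsto cW pW (hCS W cW pW ε he).1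
  have tV := bound_trunc uV bV
  have tW := bound_trunc uW bW
  have lim : Tendsto (fun T => ∑ k ∈ S, ‖fcoef d (cmp (rem f) (trunc V T) (trunc W T)) k‖^2 *
      (1 + ∑ j, ((k j : ℝ))^2) ^ (m : ℝ)) atTop
      (𝓝 (∑ k ∈ S, ‖fcoef d (cmp (rem f) V W) k‖^2 * (1 + ∑ j, ((k j : ℝ))^2) ^ (m : ℝ))) := by
    refine tendsto_finsetSum _ fun k _ => ?_
    exact (((fcoef_tendsto (rem_contDiff hf).continuous uV uW tV tW k).norm).pow 2).mul_const _
  refine le_of_tendsto lim ?_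
  filter_upwards [tV, tW] with T h1 h2
  refine hC (trunc V T) (trunc W T) (trunc_contDiff V T) (trunc_contDiff W T) (trunc_per V T)
    (trunc_per W T) (by simpa using h1) (by simpa using h2) a ε (sum_trunc_le ha T)
    (sum_trunc_le he T) ?_ S
  exact (hCS (trunc W T) (trunc_contDiff (n := 0) W T).continuous (trunc_per W T) ε
    (sum_trunc_le he T)).2

end
end S15

/-- Quadratic (Taylor-remainder) estimate for the left composition operator
`V ↦ g(·,V)` on `H^m(𝕋^d)`, `m > d/2`: for `g ∈ C^{m+2}` on `𝕋^d × B` and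
`V, V+W` taking values in `B`,
`‖g(·,V+W) - g(·,V) - ∂ₓg(·,V) W‖_{H^m} ≤ C(‖V‖_∞)(1 + ‖V‖_{H^m})‖W‖²_{H^m}`,
with `C` depending on `m`, `d` and bounds on derivatives of `g`. -/
theorem stmt15 (d m : ℕ) (hm : (d : ℝ) / 2 < m) (R : ℝ) (hR : 0 < R)
    (g : (Fin d → ℝ) → ℝ → ℝ)
    (hg : ContDiff ℝ (m + 2 : ℕ) (fun p : (Fin d → ℝ) × ℝ => g p.1 p.2))
    (hgp : ∀ x : ℝ, IsPeriodic d (fun θ => g θ x)) :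
    ∃ C : ℝ → ℝ, (∀ s : ℝ, 0 < C s) ∧
      ∀ V W : (Fin d → ℝ) → ℝ,
        Continuous V → Continuous W → IsPeriodic d V → IsPeriodic d W →
        Summable (fun k : Fin d → ℤ =>
          ‖fcoef d V k‖^2 * (1 + ∑ j, ((k j : ℝ))^2) ^ (m : ℝ)) →
        Summable (fun k : Fin d → ℤ =>
          ‖fcoef d W k‖^2 * (1 + ∑ j, ((k j : ℝ))^2) ^ (m : ℝ)) →
        (∀ θ, V θ ∈ Metric.ball (0 : ℝ) R) →
        (∀ θ, V θ + W θ ∈ Metric.ball (0 : ℝ) R) →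
        sobNorm d m (fun θ =>
            g θ (V θ + W θ) - g θ (V θ) - deriv (fun x => g θ x) (V θ) * W θ)
          ≤ C (⨆ θ, |V θ|) * (1 + sobNorm d m V) * (sobNorm d m W) ^ 2 := by
  have hdm : d < 2 * m := by
    have h2 : (d : ℝ) < 2 * m := by linarith
    exact_mod_cast h2
  obtain ⟨C, hC⟩ := S15.main hdm hg hgp (⟨2 * R, by positivity⟩ : NNReal)
  refine ⟨fun _ => (C : ℝ) + 1, fun _ => by positivity, ?_⟩
  intro V W cV cW pV pW sV sW bV bVW
  have fin : ∀ u : (Fin d → ℝ) → ℝ, Summable (fun k : Fin d → ℤ =>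
      ‖fcoef d u k‖^2 * (1 + ∑ j, ((k j : ℝ))^2) ^ (m : ℝ)) → ∀ S : Finset (Fin d → ℤ),
      ∑ k ∈ S, ‖fcoef d u k‖^2 * (1 + ∑ j, ((k j : ℝ))^2) ^ (m : ℝ) ≤ (sobNorm d m u) ^ 2 := by
    intro u hu S
    have h0 : 0 ≤ sobSq d m u := tsum_nonneg fun k => by positivity
    rw [sobNorm, Real.sq_sqrt h0]
    exact hu.sum_le_tsum S (fun k _ => by positivity)
  have nn : ∀ u : (Fin d → ℝ) → ℝ, 0 ≤ sobNorm d m u := fun u => Real.sqrt_nonneg _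
  have key := hC V W cV cW pV pW
    (fun θ => by
      have := bV θ
      rw [mem_ball_zero_iff, Real.norm_eq_abs] at this
      change |V θ| ≤ 2 * R
      linarith)
    (fun θ => by
      have h1 := bV θ
      have h2 := bVW θ
      rw [mem_ball_zero_iff, Real.norm_eq_abs, abs_lt] at h1 h2
      change |W θ| ≤ 2 * R
      rw [abs_le]
      constructor <;> linarith)
    ⟨sobNorm d m V, nn V⟩ ⟨sobNorm d m W, nn W⟩ (fin V sV) (fin W sW)
  have hd : Differentiable ℝ (fun p : (Fin d → ℝ) × ℝ => g p.1 p.2) :=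
    hg.differentiable (by norm_cast)
  have hF : (fun θ => g θ (V θ + W θ) - g θ (V θ) - deriv (fun x => g θ x) (V θ) * W θ) =
      S15.cmp (S15.rem (fun p : (Fin d → ℝ) × ℝ => g p.1 p.2)) V W := by
    ext θ
    simp only [S15.cmp, S15.rem]
    rw [(S15.hasDerivAt_dx hd θ (V θ)).deriv]
  rw [hF]
  have hV := nn V
  have hW := nn W
  have hb : sobNorm d m (S15.cmp (S15.rem (fun p : (Fin d → ℝ) × ℝ => g p.1 p.2)) V W) ≤
      (C : ℝ) * (1 + sobNorm d m V) * sobNorm d m W ^ 2 := by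
    refine (Real.sqrt_le_left (by positivity)).2 ?_
    exact Real.tsum_le_of_sum_le (fun k => by positivity) key
  refine hb.trans ?_
  gcongr
  linarith
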